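/- Let G be a countable group with at least 3 elements. Then there exists a simple group S and an injective group homomorphism φ : G → S such that for every p ∈ {2, 3, 4, ...} ∪ {∞}, there exists an element x ∈ S of order p with S generated by φ(G) ∪ {x}. -/

import Mathlib

/-- A group all of whose normal subgroups meeting a given subset nontrivially contain a subgroup
normally generating the group has a simple quotient preserving that subset. -/
theorem exists_simple_quotient {G Γ : Type} [Group G] [Nontrivial G] [Group Γ] (V : Subgroup Γ)
    (φ : G →* Γ) (hφ : ∀ g, g ≠ 1 → ∀ N : Subgroup Γ, N.Normal → φ g ∈ N → V ≤ N)
    (hφ' : Function.Injective φ) (hV : ∀ N : Subgroup Γ, N.Normal → V ≤ N → N = ⊤)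
    (hp : ∀ p : ℕ, (p = 0 ∨ 2 ≤ p) → ∃ x : Γ, orderOf x = p ∧
      Subgroup.closure (Set.range φ ∪ {x}) = ⊤ ∧
      ∀ k, x ^ k ≠ 1 → ∀ N : Subgroup Γ, N.Normal → x ^ k ∈ N → V ≤ N) :
    ∃ (S : Type) (_ : Group S), IsSimpleGroup S ∧ ∃ φ : G →* S, Function.Injective φ ∧
      ∀ p : ℕ, (p = 0 ∨ 2 ≤ p) →
        ∃ x : S, orderOf x = p ∧ Subgroup.closure (Set.range φ ∪ {x}) = ⊤ := by
  obtain ⟨g, hg⟩ := exists_ne (1 : G)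
  obtain ⟨N, hN⟩ : ∃ N, Maximal (fun N : Subgroup Γ => N.Normal ∧ φ g ∉ N) N := by
    have chain : ∀ c ⊆ {N : Subgroup Γ | N.Normal ∧ φ g ∉ N}, IsChain (· ≤ ·) c → ∀ M ∈ c,
        ∃ ub ∈ {N : Subgroup Γ | N.Normal ∧ φ g ∉ N}, ∀ z ∈ c, z ≤ ub := by
      intro c hc hcc M hM
      refine ⟨sSup c, ⟨Subgroup.sSup_normal c fun H hH => (hc hH).1, ?_⟩, fun K hK => le_sSup hK⟩
      rw [Subgroup.mem_sSup_of_directedOn ⟨M, hM⟩ hcc.directedOn]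
      rintro ⟨K, hK, hn⟩
      exact (hc hK).2 hn
    obtain ⟨N, -, hN⟩ := zorn_le_nonempty₀ _ chain ⊥
      ⟨inferInstance, by rwa [Subgroup.mem_bot, map_eq_one_iff φ hφ']⟩
    exact ⟨N, hN⟩
  have hn : N.Normal := hN.prop.1
  have hVN : ¬ V ≤ N := fun h => hN.prop.2 (by rw [hV N hn h]; trivial)
  have hS : IsSimpleGroup (Γ ⧸ N) := by
    refine { exists_pair_ne := ⟨(φ g : Γ ⧸ N), 1, fun e => ?_⟩, eq_bot_or_eq_top_of_normal := ?_ }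
    · exact hN.prop.2 ((QuotientGroup.eq_one_iff _).1 e)
    · intro H hH
      have hle : N ≤ H.comap (QuotientGroup.mk' N) := QuotientGroup.le_comap_mk' N H
      have hs := QuotientGroup.mk'_surjective N
      by_cases h : φ g ∈ H.comap (QuotientGroup.mk' N)
      · right
        have := hV _ (hH.comap _) (hφ g hg _ (hH.comap _) h)
        rw [← Subgroup.map_comap_eq_self_of_surjective hs H, this,
          Subgroup.map_top_of_surjective _ hs]
      · left
        have := hN.le_of_ge (y := H.comap (QuotientGroup.mk' N)) ⟨hH.comap _, h⟩ hle
        rw [← Subgroup.map_comap_eq_self_of_surjective hs H, eq_bot_iff,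
          Subgroup.map_le_iff_le_comap]
        exact this.trans (QuotientGroup.le_comap_mk' N ⊥)
  refine ⟨Γ ⧸ N, inferInstance, hS, (QuotientGroup.mk' N).comp φ, ?_, fun p h => ?_⟩
  · rw [injective_iff_map_eq_one]
    intro k hk
    by_contra h
    exact hVN (hφ k h N hn ((QuotientGroup.eq_one_iff _).1 hk))
  · obtain ⟨x, h1, h2, h3⟩ := hp p h
    refine ⟨x, ?_, ?_⟩
    · rw [← h1]
      refine orderOf_eq_orderOf_iff.2 fun k => ⟨fun e => ?_, fun e => ?_⟩
      · by_contra hk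
        exact hVN (h3 k hk N hn ((QuotientGroup.eq_one_iff _).1 e))
      · rw [← QuotientGroup.mk_pow, e, QuotientGroup.mk_one]
    · have := congrArg (Subgroup.map (QuotientGroup.mk' N)) h2
      rw [MonoidHom.map_closure, Subgroup.map_top_of_surjective _ (QuotientGroup.mk'_surjective N),
        Set.image_union, ← Set.range_comp, Set.image_singleton] at this
      exact this

namespace CellPerm

open Equiv

/-! ### Points, words and cells -/

/-- A point of the space tiled by copies of `ℕ × ℕ` indexed by `J`. -/
abbrev Pt (J : Type) := J × (ℕ × ℕ)

/-- A cell: a tile together with a finite binary address. -/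
abbrev Cell (J : Type) := J × List Bool

/-- The two contractions of a tile, with disjoint images covering the tile. -/
def shift (b : Bool) (y : ℕ × ℕ) : ℕ × ℕ := (Nat.bit b y.1, y.2)

/-- The composite contraction attached to a binary word. -/
def word (w : List Bool) (y : ℕ × ℕ) : ℕ × ℕ := w.foldr shift y

theorem shift_inj {b b' : Bool} {y y' : ℕ × ℕ} (h : shift b y = shift b' y') :
    b = b' ∧ y = y' := by
  simp only [shift, Prod.mk.injEq] at h
  obtain ⟨h1, h2⟩ := h
  have hb : b = b' := by simpa using congrArg Nat.bodd h1
  have hy : y.1 = y'.1 := by simpa using congrArg Nat.div2 h1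
  exact ⟨hb, Prod.ext hy h2⟩

theorem exists_shift (y : ℕ × ℕ) : ∃ b z, y = shift b z :=
  ⟨Nat.bodd y.1, (Nat.div2 y.1, y.2), by simp [shift]⟩

theorem word_append (u v : List Bool) (y : ℕ × ℕ) : word (u ++ v) y = word u (word v y) := by
  simp [word]

theorem word_injective (w : List Bool) : Function.Injective (word w) := by
  induction w with
  | nil => exact fun _ _ h => h
  | cons b w ih => exact fun y z h => ih (shift_inj h).2

theorem comparable_of_word_eq {u v : List Bool} {y z : ℕ × ℕ} (h : word u y = word v z) :
    u <+: v ∨ v <+: u := by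
  induction u generalizing v with
  | nil => exact Or.inl ⟨_, rfl⟩
  | cons b u ih =>
    cases v with
    | nil => exact Or.inr ⟨_, rfl⟩
    | cons c v =>
      obtain ⟨rfl, h2⟩ := shift_inj h
      simpa using ih h2

theorem exists_word (n : ℕ) (y : ℕ × ℕ) : ∃ w z, w.length = n ∧ y = word w z := by
  induction n generalizing y with
  | zero => exact ⟨[], y, rfl, rfl⟩
  | succ n ih =>
    obtain ⟨b, z, rfl⟩ := exists_shift y
    obtain ⟨w, z', hw, rfl⟩ := ih z
    exact ⟨b :: w, z', by simp [hw], rfl⟩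

variable {J : Type}

/-- The parametrisation of a cell. -/
def place (c : Cell J) (y : ℕ × ℕ) : Pt J := (c.1, word c.2 y)

/-- The subcell with relative address `w`. -/
def sub (c : Cell J) (w : List Bool) : Cell J := (c.1, c.2 ++ w)

theorem place_sub (c : Cell J) (w : List Bool) (y : ℕ × ℕ) :
    place (sub c w) y = place c (word w y) := by
  simp [place, sub, word_append]

theorem place_injective (c : Cell J) : Function.Injective (place c) :=
  fun _ _ h => word_injective _ (Prod.ext_iff.1 h).2

theorem exists_place (n : ℕ) (x : Pt J) : ∃ w z, w.length = n ∧ x = place (x.1, w) z := by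
  obtain ⟨w, z, hw, h⟩ := exists_word n x.2
  exact ⟨w, z, hw, Prod.ext rfl h⟩

/-- Two cells with disjoint images. -/
def Apart (c d : Cell J) : Prop := ∀ y z, place c y ≠ place d z

theorem Apart.symm {c d : Cell J} (h : Apart c d) : Apart d c := fun y z e => h z y e.symm

theorem apart_iff {c d : Cell J} :
    Apart c d ↔ (c.1 = d.1 → ¬ c.2 <+: d.2 ∧ ¬ d.2 <+: c.2) := by
  constructor
  · intro h e
    constructor
    · rintro ⟨t, ht⟩
      exact h (word t (0, 0)) (0, 0) (Prod.ext e (by simp [place, ← ht, word_append]))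
    · rintro ⟨t, ht⟩
      exact h (0, 0) (word t (0, 0)) (Prod.ext e (by simp [place, ← ht, word_append]))
  · intro h y z e
    obtain ⟨e1, e2⟩ := Prod.ext_iff.1 e
    rcases comparable_of_word_eq e2 with h' | h'
    · exact (h e1).1 h'
    · exact (h e1).2 h'

instance [DecidableEq J] (c d : Cell J) : Decidable (Apart c d) :=
  decidable_of_iff _ apart_iff.symm

theorem apart_of_fst_ne {c d : Cell J} (h : c.1 ≠ d.1) : Apart c d :=
  apart_iff.2 fun e => absurd e h

theorem Apart.sub_left {c d : Cell J} (h : Apart c d) (w : List Bool) : Apart (sub c w) d :=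
  fun y z => by rw [place_sub]; exact h _ _

theorem Apart.sub_right {c d : Cell J} (h : Apart c d) (w : List Bool) : Apart c (sub d w) :=
  (h.symm.sub_left w).symm

theorem apart_sub_sub (c : Cell J) {u v : List Bool} (h : ¬ u <+: v ∧ ¬ v <+: u) :
    Apart (sub c u) (sub c v) :=
  apart_iff.2 fun _ => by simpa [sub] using h

theorem not_apart_self (c : Cell J) : ¬ Apart c c := fun h => h (0, 0) (0, 0) rfl

/-! ### Permutations moving cells -/

theorem apply_inv {α : Type*} (h : Perm α) (x : α) : h (h⁻¹ x) = x := h.apply_symm_apply x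

theorem inv_apply {α : Type*} (h : Perm α) (x : α) : h⁻¹ (h x) = x := h.symm_apply_apply x

/-- `h` carries the cell `c` onto the cell `d`, respecting the parametrisations. -/
def Maps (h : Perm (Pt J)) (c d : Cell J) : Prop := ∀ y, h (place c y) = place d y

theorem Maps.sub {h : Perm (Pt J)} {c d : Cell J} (H : Maps h c d) (w : List Bool) :
    Maps h (CellPerm.sub c w) (CellPerm.sub d w) := fun y => by
  rw [place_sub, place_sub, H]

theorem Maps.append {h : Perm (Pt J)} {i j : J} {u v : List Bool} (H : Maps h (i, u) (j, v))
    (w : List Bool) : Maps h (i, u ++ w) (j, v ++ w) := H.sub w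

theorem Maps.inv {h : Perm (Pt J)} {c d : Cell J} (H : Maps h c d) : Maps h⁻¹ d c :=
  fun y => by rw [Perm.inv_eq_iff_eq, H]

theorem Maps.mul {g h : Perm (Pt J)} {c d e : Cell J} (H' : Maps g d e) (H : Maps h c d) :
    Maps (g * h) c e := fun y => by rw [Perm.mul_apply, H, H']

theorem Maps.apart {h : Perm (Pt J)} {c d c' d' : Cell J} (H : Maps h c c') (H' : Maps h d d')
    (hcd : Apart c d) : Apart c' d' := fun y z e => by
  rw [← H, ← H'] at e
  exact hcd y z (h.injective e)

/-- `t` permutes the three cells `a`, `b`, `c` cyclically and fixes everything else. -/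
structure IsTri (t : Perm (Pt J)) (a b c : Cell J) : Prop where
  ab : Maps t a b
  bc : Maps t b c
  ca : Maps t c a
  fix : ∀ x, (∀ y, x ≠ place a y) → (∀ y, x ≠ place b y) → (∀ y, x ≠ place c y) → t x = x

/-- `t` exchanges the cells `a`, `b` and fixes everything else. -/
structure IsSwap (t : Perm (Pt J)) (a b : Cell J) : Prop where
  ab : Maps t a b
  ba : Maps t b a
  fix : ∀ x, (∀ y, x ≠ place a y) → (∀ y, x ≠ place b y) → t x = x

theorem IsTri.rot {t : Perm (Pt J)} {a b c : Cell J} (h : IsTri t a b c) : IsTri t b c a :=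
  ⟨h.bc, h.ca, h.ab, fun x hb hc ha => h.fix x ha hb hc⟩

theorem IsTri.inv {t : Perm (Pt J)} {a b c : Cell J} (h : IsTri t a b c) : IsTri t⁻¹ a c b :=
  ⟨h.ca.inv, h.bc.inv, h.ab.inv, fun x ha hb hc => by
    rw [Perm.inv_eq_iff_eq, h.fix x ha hc hb]⟩

theorem IsTri.maps_of_apart {t : Perm (Pt J)} {a b c d : Cell J} (h : IsTri t a b c)
    (ha : Apart d a) (hb : Apart d b) (hc : Apart d c) : Maps t d d :=
  fun y => h.fix _ (ha y) (hb y) (hc y)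

theorem IsSwap.maps_of_apart {t : Perm (Pt J)} {a b d : Cell J} (h : IsSwap t a b)
    (ha : Apart d a) (hb : Apart d b) : Maps t d d :=
  fun y => h.fix _ (ha y) (hb y)

theorem ne_place_of_inv {h : Perm (Pt J)} {c d : Cell J} (H : Maps h c d) {x : Pt J}
    (hx : ∀ y, x ≠ place d y) (y : ℕ × ℕ) : h⁻¹ x ≠ place c y := fun e =>
  hx y (by rw [← H, ← e, apply_inv])

theorem IsTri.conj {t h : Perm (Pt J)} {a b c a' b' c' : Cell J} (T : IsTri t a b c)
    (ha : Maps h a a') (hb : Maps h b b') (hc : Maps h c c') : IsTri (h * t * h⁻¹) a' b' c' :=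
  ⟨(hb.mul T.ab).mul ha.inv, (hc.mul T.bc).mul hb.inv, (ha.mul T.ca).mul hc.inv,
    fun x h1 h2 h3 => by
      rw [Perm.mul_apply, Perm.mul_apply, T.fix _ (ne_place_of_inv ha h1) (ne_place_of_inv hb h2)
        (ne_place_of_inv hc h3), apply_inv]⟩

theorem IsSwap.unique {t t' : Perm (Pt J)} {a b : Cell J} (h : IsSwap t a b)
    (h' : IsSwap t' a b) : t = t' := by
  ext1 x
  by_cases ha : ∃ y, x = place a y
  · obtain ⟨y, rfl⟩ := ha
    rw [h.ab, h'.ab]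
  by_cases hb : ∃ y, x = place b y
  · obtain ⟨y, rfl⟩ := hb
    rw [h.ba, h'.ba]
  push Not at ha hb
  rw [h.fix x ha hb, h'.fix x ha hb]

/-- The commutator of two permutations whose supports meet in a single cell. -/
theorem isTri_commutator {α γ : Perm (Pt J)} {k a c : Cell J}
    (H : ∀ x, α x = x ∨ γ x = x ∨ ∃ y, x = place k y)
    (ha : Maps α k a) (hc : Maps γ k c) (hka : Apart k a) (hkc : Apart k c) :
    IsTri (α * γ * α⁻¹ * γ⁻¹) k a c := by
  have fa : ∀ y, γ (place a y) = place a y := fun y => by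
    rcases H (place a y) with h | h | ⟨z, h⟩
    · rw [← ha] at h
      exact absurd (α.injective h).symm (by rw [ha]; exact hka y y)
    · exact h
    · exact absurd h.symm (hka z y)
  have fc : ∀ y, α (place c y) = place c y := fun y => by
    rcases H (place c y) with h | h | ⟨z, h⟩
    · exact h
    · rw [← hc] at h
      exact absurd (γ.injective h).symm (by rw [hc]; exact hkc y y)
    · exact absurd h.symm (hkc z y)
  have pa : ∀ y, γ (α⁻¹ (place k y)) = α⁻¹ (place k y) := fun y => by
    rcases H (α⁻¹ (place k y)) with h | h | ⟨z, h⟩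
    · rw [apply_inv] at h
      have := ha y
      rw [h, apply_inv] at this
      exact absurd this (hka y y)
    · exact h
    · have := ha z
      rw [← h, apply_inv] at this
      exact absurd this (hka y z)
  have pc : ∀ y, α (γ⁻¹ (place k y)) = γ⁻¹ (place k y) := fun y => by
    rcases H (γ⁻¹ (place k y)) with h | h | ⟨z, h⟩
    · exact h
    · rw [apply_inv] at h
      have := hc y
      rw [h, apply_inv] at this
      exact absurd this (hkc y y)
    · have := hc z
      rw [← h, apply_inv] at this
      exact absurd this (hkc y z)
  refine ⟨fun y => ?_, fun y => ?_, fun y => ?_, fun x h1 h2 h3 => ?_⟩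
  · simp only [Perm.mul_apply]
    rw [Perm.inv_eq_iff_eq.2 (pc y).symm, apply_inv, ha]
  · simp only [Perm.mul_apply]
    rw [Perm.inv_eq_iff_eq.2 (fa y).symm, ha.inv, hc, fc]
  · simp only [Perm.mul_apply]
    rw [hc.inv, pa, apply_inv]
  · simp only [Perm.mul_apply]
    by_cases hx : γ x = x
    · rw [Perm.inv_eq_iff_eq.2 hx.symm]
      rcases H (α⁻¹ x) with h | h | h
      · rw [apply_inv] at h
        have h' := apply_inv α x
        rw [← h] at h' ⊢
        rw [hx, h']
      · rw [h, apply_inv]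
      · obtain ⟨y, h⟩ := h
        exact absurd (by rw [← ha, ← h, apply_inv]) (h2 y)
    · have hαx : α x = x := by
        rcases H x with h | h | ⟨y, h⟩
        · exact h
        · exact absurd h hx
        · exact absurd h (h1 y)
      have : α (γ⁻¹ x) = γ⁻¹ x := by
        rcases H (γ⁻¹ x) with h | h | ⟨y, h⟩
        · exact h
        · rw [apply_inv] at h
          have h' := apply_inv γ x
          rw [← h] at h'
          exact absurd h' hx
        · exact absurd (by rw [← hc, ← h, apply_inv]) (h3 y)
      rw [Perm.inv_eq_iff_eq.2 this.symm, apply_inv, hαx]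

/-! ### Permutations of finite families of cells -/

/-- The embedding parametrising a family of pairwise disjoint cells. -/
def family {ι : Type} (F : ι → Cell J) (hF : Pairwise fun i j => Apart (F i) (F j)) :
    ι × (ℕ × ℕ) ↪ Pt J :=
  ⟨fun p => place (F p.1) p.2, fun p q h => by
    have e : p.1 = q.1 := by
      by_contra hne
      exact hF hne _ _ h
    refine Prod.ext e (place_injective (F p.1) ?_)
    dsimp only at h
    rw [h, e]⟩

/-- A permutation of the index set of a family of disjoint cells permutes the cells. -/
noncomputable def act {ι : Type} (F : ι → Cell J) (hF : Pairwise fun i j => Apart (F i) (F j)) :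
    Perm ι →* Perm (Pt J) :=
  (Perm.viaEmbeddingHom (family F hF)).comp
    { toFun := fun σ => σ.prodCongr (Equiv.refl _)
      map_one' := rfl
      map_mul' := fun _ _ => rfl }

section act

variable {ι : Type} {F : ι → Cell J} {hF : Pairwise fun i j => Apart (F i) (F j)}

theorem act_maps (σ : Perm ι) (i : ι) : Maps (act F hF σ) (F i) (F (σ i)) := fun y =>
  Perm.viaEmbedding_apply (σ.prodCongr (Equiv.refl _)) (family F hF) (i, y)

theorem act_fix (σ : Perm ι) {x : Pt J} (hx : ∀ i y, x ≠ place (F i) y) : act F hF σ x = x :=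
  Perm.viaEmbedding_apply_of_notMem _ (family F hF) x (by
    rintro ⟨⟨i, y⟩, h⟩
    exact hx i y h.symm)

theorem act_fixes (σ : Perm ι) {c : Cell J} (hc : ∀ i, Apart c (F i)) : Maps (act F hF σ) c c :=
  fun y => act_fix σ fun i z => hc i y z

theorem act_fix_of_fst (σ : Perm ι) {x : Pt J} (hx : ∀ i, x.1 ≠ (F i).1) : act F hF σ x = x :=
  act_fix σ fun i y e => hx i (by rw [e]; rfl)

theorem act_injective : Function.Injective (act F hF) := fun σ τ h => by
  ext1 i
  by_contra hne
  have h1 := act_maps (hF := hF) σ i (0, 0)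
  rw [h, act_maps (hF := hF) τ i (0, 0)] at h1
  exact hF (fun e => hne e.symm) _ _ h1

theorem act_unique (σ : Perm ι) {g : Perm (Pt J)} (h1 : ∀ i, Maps g (F i) (F (σ i)))
    (h2 : ∀ x, (∀ i y, x ≠ place (F i) y) → g x = x) : g = act F hF σ := by
  ext1 x
  by_cases hx : ∃ i y, x = place (F i) y
  · obtain ⟨i, y, rfl⟩ := hx
    rw [h1, act_maps]
  · push Not at hx
    rw [h2 x hx, act_fix σ hx]

end act

theorem act_conj {ι : Type} {F F' : ι → Cell J} {hF : Pairwise fun i j => Apart (F i) (F j)}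
    {hF' : Pairwise fun i j => Apart (F' i) (F' j)} {g : Perm (Pt J)}
    (hg : ∀ i, Maps g (F i) (F' i)) (σ : Perm ι) : g * act F hF σ * g⁻¹ = act F' hF' σ :=
  act_unique σ (fun i => ((hg _).mul (act_maps σ i)).mul (hg i).inv) fun x hx => by
    rw [Perm.mul_apply, Perm.mul_apply, act_fix σ fun i => ne_place_of_inv (hg i) (hx i), apply_inv]

/-- The group generated by all exchanges of two disjoint cells. -/
def swapGroup (J : Type) : Subgroup (Perm (Pt J)) :=
  Subgroup.closure {t | ∃ a b : Cell J, Apart a b ∧ IsSwap t a b}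

theorem isSwap_act {ι : Type} [DecidableEq ι] {F : ι → Cell J}
    {hF : Pairwise fun i j => Apart (F i) (F j)} (i j : ι) :
    IsSwap (act F hF (swap i j)) (F i) (F j) := by
  refine ⟨?_, ?_, fun x h1 h2 => ?_⟩
  · simpa using act_maps (hF := hF) (swap i j) i
  · simpa using act_maps (hF := hF) (swap i j) j
  · by_cases hx : ∃ k y, x = place (F k) y
    · obtain ⟨k, y, rfl⟩ := hx
      have hi : k ≠ i := by rintro rfl; exact h1 y rfl
      have hj : k ≠ j := by rintro rfl; exact h2 y rfl
      rw [act_maps, swap_apply_of_ne_of_ne hi hj]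
    · push Not at hx
      exact act_fix _ hx

theorem act_mem_swapGroup {ι : Type} [Finite ι] (F : ι → Cell J)
    (hF : Pairwise fun i j => Apart (F i) (F j)) (σ : Perm ι) : act F hF σ ∈ swapGroup J := by
  classical
  have h : (⊤ : Subgroup (Perm ι)) ≤ (swapGroup J).comap (act F hF) := by
    rw [← Perm.closure_isSwap, Subgroup.closure_le]
    rintro τ ⟨i, j, hij, rfl⟩
    exact Subgroup.subset_closure ⟨F i, F j, hF hij, isSwap_act i j⟩
  exact h (Subgroup.mem_top σ)

theorem pairwise_apart_pair {a b : Cell J} (h : Apart a b) :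
    Pairwise fun i j : Bool => Apart (cond i a b) (cond j a b) := by
  rintro (_ | _) (_ | _) hij
  · exact absurd rfl hij
  · exact h.symm
  · exact h
  · exact absurd rfl hij

theorem exists_isSwap {a b : Cell J} (h : Apart a b) : ∃ t ∈ swapGroup J, IsSwap t a b :=
  ⟨act _ (pairwise_apart_pair h) (swap true false), act_mem_swapGroup _ _ _, isSwap_act true false⟩

/-! ### Three-cycles of cells in a subgroup -/

/-- The subgroup `L` contains the cyclic permutation of three pairwise disjoint cells. -/
def Tri (L : Subgroup (Perm (Pt J))) (a b c : Cell J) : Prop :=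
  (Apart a b ∧ Apart a c ∧ Apart b c) ∧ ∃ t ∈ L, IsTri t a b c

section Tri

variable {L : Subgroup (Perm (Pt J))} {a b c d e : Cell J}

theorem Tri.rot (h : Tri L a b c) : Tri L b c a := by
  obtain ⟨⟨h1, h2, h3⟩, t, ht, T⟩ := h
  exact ⟨⟨h3, h1.symm, h2.symm⟩, t, ht, T.rot⟩

theorem Tri.swap (h : Tri L a b c) : Tri L a c b := by
  obtain ⟨⟨h1, h2, h3⟩, t, ht, T⟩ := h
  exact ⟨⟨h2, h1, h3.symm⟩, t⁻¹, L.inv_mem ht, T.inv⟩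

theorem Tri.conj (h : Tri L a b c) {g : Perm (Pt J)} (hg : ∀ t ∈ L, g * t * g⁻¹ ∈ L)
    {a' b' c' : Cell J} (ha : Maps g a a') (hb : Maps g b b') (hc : Maps g c c') :
    Tri L a' b' c' := by
  obtain ⟨⟨h1, h2, h3⟩, t, ht, T⟩ := h
  exact ⟨⟨ha.apart hb h1, ha.apart hc h2, hb.apart hc h3⟩, _, hg t ht, T.conj ha hb hc⟩

theorem Tri.conj_mem (h : Tri L a b c) {g : Perm (Pt J)} (hg : g ∈ L)
    {a' b' c' : Cell J} (ha : Maps g a a') (hb : Maps g b b') (hc : Maps g c c') :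
    Tri L a' b' c' :=
  h.conj (fun _ ht => L.mul_mem (L.mul_mem hg ht) (L.inv_mem hg)) ha hb hc

/-- Replacing one leg of a three-cycle by means of another three-cycle. -/
theorem Tri.replace (h : Tri L a b c) (h' : Tri L c d e) (hac : Apart a d) (hae : Apart a e)
    (hbd : Apart b d) (hbe : Apart b e) : Tri L a b d := by
  obtain ⟨-, t, ht, T⟩ := h'
  exact h.conj_mem ht (T.maps_of_apart h.1.2.1 hac hae) (T.maps_of_apart h.1.2.2 hbd hbe) T.ab

/-- All three-cycles on a family of cells lie in `L`. -/
def Alt {n : ℕ} (L : Subgroup (Perm (Pt J))) (f : Fin n → Cell J) : Prop :=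
  ∀ i j k, i ≠ j → i ≠ k → j ≠ k → Tri L (f i) (f j) (f k)

/-- Two three-cycles sharing a cell generate all three-cycles on the five cells. -/
theorem alt_join (h : Tri L a b c) (h' : Tri L c d e) (had : Apart a d) (hae : Apart a e)
    (hbd : Apart b d) (hbe : Apart b e) : Alt L ![a, b, c, d, e] := by
  have abd : Tri L a b d := h.replace h' had hae hbd hbe
  have abe : Tri L a b e := h.replace h'.swap hae had hbe hbd
  have dea : Tri L d e a :=
    h'.rot.replace h.rot.rot had.symm hbd.symm hae.symm hbe.symm
  have deb : Tri L d e b :=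
    h'.rot.replace h.rot.rot.swap hbd.symm had.symm hbe.symm hae.symm
  have acd : Tri L a c d := by
    obtain ⟨-, t, ht, T⟩ := h
    have h1 := abd.conj_mem ht T.ab T.bc (T.maps_of_apart had.symm hbd.symm h'.1.1.symm)
    exact h1.conj_mem ht T.bc T.ca (T.maps_of_apart had.symm hbd.symm h'.1.1.symm) |>.swap.rot.rot
  have bcd : Tri L b c d := by
    obtain ⟨-, t, ht, T⟩ := h
    exact abd.conj_mem ht T.ab T.bc (T.maps_of_apart had.symm hbd.symm h'.1.1.symm)
  have ace : Tri L a c e := by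
    obtain ⟨-, t, ht, T⟩ := h
    have h1 := abe.conj_mem ht T.ab T.bc (T.maps_of_apart hae.symm hbe.symm h'.1.2.1.symm)
    exact h1.conj_mem ht T.bc T.ca (T.maps_of_apart hae.symm hbe.symm h'.1.2.1.symm) |>.swap.rot.rot
  have bce : Tri L b c e := by
    obtain ⟨-, t, ht, T⟩ := h
    exact abe.conj_mem ht T.ab T.bc (T.maps_of_apart hae.symm hbe.symm h'.1.2.1.symm)
  have key : ∀ i j k : Fin 5, i < j → j < k → Tri L (![a, b, c, d, e] i) (![a, b, c, d, e] j)
      (![a, b, c, d, e] k) := by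
    intro i j k hij hjk
    fin_cases i <;> fin_cases j <;> first
      | exact absurd hij (by decide)
      | (fin_cases k <;> first
          | exact absurd hjk (by decide)
          | exact h | exact h' | exact abd | exact abe | exact dea.rot.rot | exact deb.rot.rot
          | exact acd | exact ace | exact bcd | exact bce)
  intro i j k hij hik hjk
  rcases lt_or_gt_of_ne hij with h1 | h1 <;> rcases lt_or_gt_of_ne hjk with h2 | h2 <;>
    rcases lt_or_gt_of_ne hik with h3 | h3
  · exact key i j k h1 h2
  · exact absurd (h1.trans h2) (lt_asymm h3)
  · exact (key i k j h3 h2).swap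
  · exact (key k i j h3 h1).rot
  · exact (key j i k h1 h3).swap.rot.rot
  · exact (key j k i h2 h3).rot.rot
  · exact absurd (h2.trans h1) (lt_asymm h3)
  · exact (key k j i h2 h1).rot.swap.rot.rot

end Tri

/-! ### Generating the group of all exchanges -/

theorem place_shift (c : Cell J) (b : Bool) (y : ℕ × ℕ) :
    place c (shift b y) = place (sub c [b]) y := by
  rw [place_sub]
  rfl

theorem maps_of_children {h : Perm (Pt J)} {c d : Cell J}
    (H : ∀ b, Maps h (sub c [b]) (sub d [b])) : Maps h c d := fun y => by
  obtain ⟨b, z, rfl⟩ := exists_shift y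
  rw [place_shift, place_shift, H]

theorem apart_children (c : Cell J) : Apart (sub c [false]) (sub c [true]) :=
  apart_sub_sub c (by decide)

theorem isSwap_of_children {t t' : Perm (Pt J)} {a b : Cell J} (hab : Apart a b)
    (h : IsSwap t (sub a [false]) (sub b [false])) (h' : IsSwap t' (sub a [true]) (sub b [true])) :
    IsSwap (t * t') a b := by
  have c := apart_children (J := J)
  have h1 := hab.symm
  refine ⟨maps_of_children ?_, maps_of_children ?_, fun x h2 h3 => ?_⟩
  · rintro (_ | _)
    · exact h.ab.mul (h'.maps_of_apart (c a) ((hab.sub_left _).sub_right _))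
    · exact (h.maps_of_apart ((h1.sub_left _).sub_right _) (c b).symm).mul h'.ab
  · rintro (_ | _)
    · exact h.ba.mul (h'.maps_of_apart ((h1.sub_left _).sub_right _) (c b))
    · exact (h.maps_of_apart (c a).symm ((hab.sub_left _).sub_right _)).mul h'.ba
  · rw [Perm.mul_apply, h'.fix, h.fix] <;> intro y <;> rw [place_sub] <;>
      first | exact h2 _ | exact h3 _

theorem isSwap_of_isTri {t t' : Perm (Pt J)} {a b : Cell J} (hab : Apart a b)
    (h : IsTri t (sub a [false]) (sub b [false]) (sub a [true]))
    (h' : IsTri t' (sub b [false]) (sub a [true]) (sub b [true])) :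
    IsSwap (t * t') a b := by
  have c := apart_children (J := J)
  have h1 := hab.symm
  refine ⟨maps_of_children ?_, maps_of_children ?_, fun x h2 h3 => ?_⟩
  · rintro (_ | _)
    · exact h.ab.mul (h'.maps_of_apart ((hab.sub_left _).sub_right _) (c a)
        ((hab.sub_left _).sub_right _))
    · exact (h.maps_of_apart ((h1.sub_left _).sub_right _) (c b).symm
        ((h1.sub_left _).sub_right _)).mul h'.bc
  · rintro (_ | _)
    · exact h.ca.mul h'.ab
    · exact h.bc.mul h'.ca
  · rw [Perm.mul_apply, h'.fix, h.fix] <;> intro y <;> rw [place_sub] <;>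
      first | exact h2 _ | exact h3 _

/-- A subgroup containing all three-cycles of small cells contains the swap group. -/
theorem swapGroup_le_of_tri {L : Subgroup (Perm (Pt J))} (N : ℕ)
    (H : ∀ a b c : Cell J, N ≤ a.2.length → N ≤ b.2.length → N ≤ c.2.length →
      Apart a b → Apart a c → Apart b c → Tri L a b c) : swapGroup J ≤ L := by
  have key : ∀ n, ∀ a b : Cell J, N ≤ a.2.length + n → N ≤ b.2.length + n → Apart a b →
      ∃ t ∈ L, IsSwap t a b := by
    intro n
    induction n with
    | zero =>
      intro a b ha hb hab
      have c := apart_children (J := J)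
      obtain ⟨-, t, ht, T⟩ := H (sub a [false]) (sub b [false]) (sub a [true])
        (by simp [sub]; omega) (by simp [sub]; omega) (by simp [sub]; omega)
        ((hab.sub_left _).sub_right _) (c a) ((hab.symm.sub_left _).sub_right _)
      obtain ⟨-, t', ht', T'⟩ := H (sub b [false]) (sub a [true]) (sub b [true])
        (by simp [sub]; omega) (by simp [sub]; omega) (by simp [sub]; omega)
        ((hab.symm.sub_left _).sub_right _) (c b) ((hab.sub_left _).sub_right _)
      exact ⟨t * t', L.mul_mem ht ht', isSwap_of_isTri hab T T'⟩
    | succ n ih =>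
      intro a b ha hb hab
      obtain ⟨t, ht, T⟩ := ih (sub a [false]) (sub b [false]) (by simp [sub]; omega)
        (by simp [sub]; omega) ((hab.sub_left _).sub_right _)
      obtain ⟨t', ht', T'⟩ := ih (sub a [true]) (sub b [true]) (by simp [sub]; omega)
        (by simp [sub]; omega) ((hab.sub_left _).sub_right _)
      exact ⟨t * t', L.mul_mem ht ht', isSwap_of_children hab T T'⟩
  rw [swapGroup, Subgroup.closure_le]
  rintro t ⟨a, b, hab, T⟩
  obtain ⟨t', ht', T'⟩ := key N a b (by omega) (by omega) hab
  rw [T.unique T']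
  exact ht'

/-! ### Growing three-cycles from a family of five cells in different tiles -/

section Good

variable {L : Subgroup (Perm (Pt J))} {f : Fin 5 → Cell J}

/-- The three-cycles formed by `c` and two members of the family in other tiles lie in `L`. -/
def Good (L : Subgroup (Perm (Pt J))) (f : Fin 5 → Cell J) (c : Cell J) : Prop :=
  ∀ i j, i ≠ j → (f i).1 ≠ c.1 → (f j).1 ≠ c.1 → Tri L c (f i) (f j)

theorem good_of_tri (hA : Alt L f) {c : Cell J}
    {k l : Fin 5} (hk : (f k).1 ≠ c.1) (hl : (f l).1 ≠ c.1)
    (h : Tri L c (f k) (f l)) : Good L f c := by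
  have step : ∀ k l n, k ≠ l → k ≠ n → l ≠ n → (f k).1 ≠ c.1 → (f l).1 ≠ c.1 → (f n).1 ≠ c.1 →
      Tri L c (f k) (f l) → Tri L c (f l) (f n) := by
    intro k l n hkl hkn hln hk hl hn h
    obtain ⟨-, t, ht, T⟩ := hA k l n hkl hkn hln
    exact h.conj_mem ht (T.maps_of_apart (apart_of_fst_ne hk.symm) (apart_of_fst_ne hl.symm)
      (apart_of_fst_ne hn.symm)) T.ab T.bc
  have hkl : k ≠ l := by
    rintro rfl
    exact not_apart_self _ h.1.2.2
  have h0 : ∀ n, n ≠ k → (f n).1 ≠ c.1 → Tri L c (f k) (f n) := by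
    intro n hn hc
    by_cases e : n = l
    · subst e; exact h
    · exact step l k n hkl.symm (Ne.symm e) hn.symm hl hk hc h.swap
  intro i j hij hi hj
  by_cases e : i = k
  · subst e; exact h0 j hij.symm hj
  by_cases e' : j = k
  · subst e'; exact (h0 i hij hi).swap
  exact step k i j (Ne.symm e) (Ne.symm e') hij hk hi hj (h0 i e hi)

theorem good_family (hA : Alt L f) (i : Fin 5) :
    Good L f (f i) := fun j k hjk hj hk =>
  hA i j k (fun e => hj (by rw [e])) (fun e => hk (by rw [e])) hjk

theorem exists_index_of_tiles (hf : Function.Injective fun i => (f i).1) (s : List J)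
    (hs : s.length ≤ 3) : ∃ k l, k ≠ l ∧ (∀ j ∈ s, (f k).1 ≠ j) ∧ ∀ j ∈ s, (f l).1 ≠ j := by
  classical
  have h1 : (Finset.univ.filter fun k => (f k).1 ∈ s).card ≤ 3 := by
    refine le_trans (Finset.card_le_card_of_injOn (t := s.toFinset) (fun i => (f i).1) ?_
      (fun _ _ _ _ h => hf h)) ((List.toFinset_card_le s).trans hs)
    intro k hk
    simpa using hk
  have h2 : 1 < (Finset.univ.filter fun k => (f k).1 ∉ s).card := by
    have := Finset.card_filter_add_card_filter_not (s := (Finset.univ : Finset (Fin 5)))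
      (fun k => (f k).1 ∈ s)
    simp only [Finset.card_univ, Fintype.card_fin] at this
    omega
  obtain ⟨k, hk, l, hl, hkl⟩ := Finset.one_lt_card.1 h2
  simp only [Finset.mem_filter, Finset.mem_univ, true_and] at hk hl
  exact ⟨k, l, hkl, fun j hj e => hk (e ▸ hj), fun j hj e => hl (e ▸ hj)⟩

/-- The element `h` of `L` carries three members of the family to good cells. -/
def Carrier (L : Subgroup (Perm (Pt J))) (f : Fin 5 → Cell J) (h : Perm (Pt J)) : Prop :=
  h ∈ L ∧ ∃ m : Fin 3 → Fin 5, Function.Injective m ∧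
    ∀ i, ∃ g, Maps h (f (m i)) g ∧ Good L f g

theorem Good.transport (hf : Function.Injective fun i => (f i).1) (hA : Alt L f)
    {h : Perm (Pt J)} (hh : Carrier L f h) {c d : Cell J} (hc : Good L f c) (hcd : Maps h c d) :
    Good L f d := by
  obtain ⟨hL, m, hm, H⟩ := hh
  have two : ∃ i j, i ≠ j ∧ (f (m i)).1 ≠ c.1 ∧ (f (m j)).1 ≠ c.1 := by
    have hne : ∀ i j, i ≠ j → (f (m i)).1 = c.1 → (f (m j)).1 ≠ c.1 := fun i j hij h1 h2 =>
      hij (hm (hf (h1.trans h2.symm)))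
    by_cases h0 : (f (m 0)).1 = c.1
    · exact ⟨1, 2, by decide, hne 0 1 (by decide) h0, hne 0 2 (by decide) h0⟩
    by_cases h1 : (f (m 1)).1 = c.1
    · exact ⟨0, 2, by decide, h0, hne 1 2 (by decide) h1⟩
    · exact ⟨0, 1, by decide, h0, h1⟩
  obtain ⟨i, j, hij, hi, hj⟩ := two
  obtain ⟨g, hg, gg⟩ := H i
  obtain ⟨g', hg', -⟩ := H j
  have T := (hc (m i) (m j) (fun e => hij (hm e)) hi hj).conj_mem hL hcd hg hg'
  obtain ⟨k, l, hkl, hk, hl⟩ := exists_index_of_tiles hf [d.1, g.1, g'.1] le_rfl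
  simp only [List.mem_cons, List.not_mem_nil, or_false, forall_eq_or_imp, forall_eq] at hk hl
  have T' := gg k l hkl hk.2.1 hl.2.1
  have J := alt_join T.swap T' (apart_of_fst_ne hk.1.symm) (apart_of_fst_ne hl.1.symm)
    (apart_of_fst_ne hk.2.2.symm) (apart_of_fst_ne hl.2.2.symm)
  exact good_of_tri hA hk.1 hl.1 (J 0 3 4 (by decide) (by decide) (by decide))

/-- If all small cells are good, then `L` contains the swap group. -/
theorem swapGroup_le_of_good (hf : Function.Injective fun i => (f i).1) (N : ℕ)
    (H : ∀ c : Cell J, N ≤ c.2.length → Good L f c) : swapGroup J ≤ L := by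
  refine swapGroup_le_of_tri N fun a b c ha hb hc hab hac hbc => ?_
  obtain ⟨k, l, hkl, hk, hl⟩ := exists_index_of_tiles hf [a.1, b.1, c.1] le_rfl
  simp only [List.mem_cons, List.not_mem_nil, or_false, forall_eq_or_imp, forall_eq] at hk hl
  have Ta := H a ha k l hkl hk.1 hl.1
  obtain ⟨-, t, ht, T⟩ := H b hb k l hkl hk.2.1 hl.2.1
  have Tab : Tri L a (f l) b := Ta.conj_mem ht
    (T.maps_of_apart hab (apart_of_fst_ne hk.1.symm) (apart_of_fst_ne hl.1.symm)) T.bc T.ca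
  obtain ⟨-, t', ht', T'⟩ := H c hc k l hkl hk.2.2 hl.2.2
  have := Tab.conj_mem ht' (T'.maps_of_apart hac (apart_of_fst_ne hk.1.symm)
    (apart_of_fst_ne hl.1.symm)) T'.ca
    (T'.maps_of_apart hbc (apart_of_fst_ne hk.2.1.symm) (apart_of_fst_ne hl.2.1.symm))
  exact this.swap

end Good

/-! ### Subgroups normalised by the swap group -/

/-- A subgroup normalised by the swap group and displacing some cell contains the swap group. -/
theorem swapGroup_le_of_displaces (hJ : ∀ s : List J, s.length ≤ 4 → ∃ j, j ∉ s)
    {N : Subgroup (Perm (Pt J))} (hN : ∀ v ∈ swapGroup J, ∀ n ∈ N, v * n * v⁻¹ ∈ N)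
    {h : Perm (Pt J)} (hh : h ∈ N) {c : Cell J} (hc : ∀ y z, h (place c y) ≠ place c z) :
    swapGroup J ≤ N := by
  have T0 : Tri N (sub c [false, true]) (sub c [false, false]) (sub c [true, false]) := by
    have h1 : Apart (sub c [false, true]) (sub c [false, false]) := apart_sub_sub c (by decide)
    have h2 : Apart (sub c [false, true]) (sub c [true, false]) := apart_sub_sub c (by decide)
    have h3 : Apart (sub c [false, false]) (sub c [true, false]) := apart_sub_sub c (by decide)
    obtain ⟨α, hα, A⟩ := exists_isSwap h1
    obtain ⟨β, hβ, B⟩ := exists_isSwap h2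
    have key : ∀ γ : Perm (Pt J), (∀ x, (∀ y, x ≠ place c y) → γ x = x) →
        Perm.Disjoint (h * α⁻¹ * h⁻¹) γ := by
      intro γ hγ x
      by_cases hx : ∃ y, x = place c y
      · obtain ⟨y, rfl⟩ := hx
        left
        have : ∀ z, h⁻¹ (place c y) ≠ place c z := fun z e =>
          hc z y (by rw [← e, apply_inv])
        rw [Perm.mul_apply, Perm.mul_apply, Perm.inv_eq_iff_eq.2, apply_inv]
        rw [A.fix] <;> intro z <;> rw [place_sub] <;> exact this _
      · push Not at hx
        exact Or.inr (hγ x hx)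
    have kα : Commute (h * α⁻¹ * h⁻¹) α := (key α fun x hx => A.fix x
      (fun y => by rw [place_sub]; exact hx _) (fun y => by rw [place_sub]; exact hx _)).commute
    have kβ : Commute (h * α⁻¹ * h⁻¹) β := (key β fun x hx => B.fix x
      (fun y => by rw [place_sub]; exact hx _) (fun y => by rw [place_sub]; exact hx _)).commute
    refine ⟨⟨h1, h2, h3⟩, _, ?_, isTri_commutator (fun x => ?_) A.ab B.ab h1 h2⟩
    · have m : α * h * α⁻¹ * h⁻¹ ∈ N := N.mul_mem (hN α hα h hh) (N.inv_mem hh)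
      have m' := N.mul_mem m (hN β hβ _ (N.inv_mem m))
      convert m' using 1
      rw [show α * h * α⁻¹ * h⁻¹ = α * (h * α⁻¹ * h⁻¹) by group]
      generalize h * α⁻¹ * h⁻¹ = δ at kα kβ
      have e := (kα.mul_right kβ).eq
      calc α * β * α⁻¹ * β⁻¹ = (α * β * δ) * δ⁻¹ * α⁻¹ * β⁻¹ := by group
        _ = (δ * (α * β)) * δ⁻¹ * α⁻¹ * β⁻¹ := by rw [e]
        _ = (δ * α) * β * δ⁻¹ * α⁻¹ * β⁻¹ := by group
        _ = α * δ * (β * (α * δ)⁻¹ * β⁻¹) := by rw [kα.eq]; group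
    · by_cases hx : ∃ y, x = place (sub c [false, true]) y
      · exact Or.inr (Or.inr hx)
      push Not at hx
      by_cases hx' : ∃ y, x = place (sub c [false, false]) y
      · obtain ⟨y, rfl⟩ := hx'
        exact Or.inr (Or.inl (B.maps_of_apart h1.symm h3 y))
      · push Not at hx'
        exact Or.inl (A.fix x hx hx')
  have rep : ∀ {a b c d : Cell J}, Tri N a b c → Apart d a → Apart d b → Apart d c →
      Tri N d b c := by
    intro a b c d T h1 h2 h3
    obtain ⟨v, hv, S⟩ := exists_isSwap h1
    exact T.conj (hN v hv) S.ba (S.maps_of_apart h2.symm T.1.1.symm)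
      (S.maps_of_apart h3.symm T.1.2.1.symm)
  have rep3 : ∀ {a b c a' b' c' : Cell J}, Tri N a b c → Apart a' b' → Apart a' c' → Apart b' c' →
      (∀ x ∈ [a, b, c], ∀ y ∈ [a', b', c'], Apart y x) → Tri N a' b' c' := by
    intro a b c a' b' c' T h1 h2 h3 h
    simp only [List.mem_cons, List.not_mem_nil, or_false, forall_eq_or_imp, forall_eq] at h
    obtain ⟨⟨haa, hba, hca⟩, ⟨hab, hbb, hcb⟩, ⟨hac, hbc, hcc⟩⟩ := h
    have T1 := rep T haa hab hac
    have T2 := rep T1.rot hbb hbc h1.symm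
    exact (rep T2.rot hcc h2.symm h3.symm).rot
  refine swapGroup_le_of_tri 0 fun a b d _ _ _ hab had hbd => ?_
  obtain ⟨j, hj⟩ := hJ [c.1, a.1, b.1, d.1] le_rfl
  simp only [List.mem_cons, List.not_mem_nil, or_false, not_or] at hj
  have T1 : Tri N (j, [false, true]) (j, [false, false]) (j, [true, false]) := by
    refine rep3 T0 (apart_iff.2 fun _ => by simp) (apart_iff.2 fun _ => by simp)
      (apart_iff.2 fun _ => by simp) fun x hx y hy => apart_of_fst_ne ?_
    have h1 : x.1 = c.1 := by
      simp only [List.mem_cons, List.not_mem_nil, or_false] at hx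
      rcases hx with rfl | rfl | rfl <;> rfl
    have h2 : y.1 = j := by
      simp only [List.mem_cons, List.not_mem_nil, or_false] at hy
      rcases hy with rfl | rfl | rfl <;> rfl
    rw [h1, h2]
    exact hj.1
  refine rep3 T1 hab had hbd fun x hx y hy => apart_of_fst_ne ?_
  have h1 : x.1 = j := by
    simp only [List.mem_cons, List.not_mem_nil, or_false] at hx
    rcases hx with rfl | rfl | rfl <;> rfl
  simp only [List.mem_cons, List.not_mem_nil, or_false] at hy
  rw [h1]
  rcases hy with rfl | rfl | rfl
  · exact Ne.symm hj.2.1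
  · exact Ne.symm hj.2.2.1
  · exact Ne.symm hj.2.2.2

/-! ### Rotations -/

/-- The rotation of the second coordinate of `ι × Fin p`, as a homomorphic image. -/
def rotHom (ι : Type) (p : ℕ) : Perm (Fin p) →* Perm (ι × Fin p) where
  toFun σ := (Equiv.refl ι).prodCongr σ
  map_one' := rfl
  map_mul' _ _ := rfl

/-- The permutation rotating each of the `p`-tuples of cells `F (i, 0), …, F (i, p - 1)`. -/
noncomputable def rot {ι : Type} {p : ℕ} (F : ι × Fin p → Cell J)
    (hF : Pairwise fun i j => Apart (F i) (F j)) : Perm (Pt J) :=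
  act F hF (rotHom ι p (finRotate p))

theorem orderOf_finRotate {p : ℕ} (hp : 2 ≤ p) : orderOf (finRotate p) = p := by
  obtain ⟨n, rfl⟩ := Nat.exists_eq_add_of_le' hp
  rw [isCycle_finRotate.orderOf, support_finRotate, Finset.card_univ, Fintype.card_fin]

theorem orderOf_rot {ι : Type} [Nonempty ι] {p : ℕ} (hp : 2 ≤ p) (F : ι × Fin p → Cell J)
    (hF : Pairwise fun i j => Apart (F i) (F j)) : orderOf (rot F hF) = p := by
  rw [rot, orderOf_injective _ act_injective, orderOf_injective, orderOf_finRotate hp]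
  intro σ τ h
  ext1 k
  obtain ⟨i⟩ := ‹Nonempty ι›
  exact (Prod.ext_iff.1 (Equiv.congr_fun h (i, k))).2

theorem rot_maps {ι : Type} {p : ℕ} {F : ι × Fin p → Cell J}
    {hF : Pairwise fun i j => Apart (F i) (F j)} (i : ι) (k : Fin p) :
    Maps (rot F hF) (F (i, k)) (F (i, finRotate p k)) := act_maps _ (i, k)

theorem rot_fixes {ι : Type} {p : ℕ} {F : ι × Fin p → Cell J}
    {hF : Pairwise fun i j => Apart (F i) (F j)} {c : Cell J} (hc : ∀ i, Apart c (F i)) :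
    Maps (rot F hF) c c := act_fixes _ hc

theorem act_displaces {ι : Type} {F : ι → Cell J} {hF : Pairwise fun i j => Apart (F i) (F j)}
    {σ : Perm ι} (h : act F hF σ ≠ 1) :
    ∃ c : Cell J, ∀ y z, act F hF σ (place c y) ≠ place c z := by
  have : ∃ i, σ i ≠ i := by
    by_contra! h'
    exact h (by rw [show σ = 1 from Equiv.ext h', map_one])
  obtain ⟨i, hi⟩ := this
  refine ⟨F i, fun y z => ?_⟩
  rw [act_maps]
  exact hF hi y z

theorem rot_pow_displaces {ι : Type} {p : ℕ} {F : ι × Fin p → Cell J}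
    {hF : Pairwise fun i j => Apart (F i) (F j)} {k : ℕ} (h : rot F hF ^ k ≠ 1) :
    ∃ c : Cell J, ∀ y z, (rot F hF ^ k) (place c y) ≠ place c z := by
  rw [rot, ← map_pow] at h ⊢
  exact act_displaces h

/-! ### The tiling with two rows of three tiles and a spare tile -/

/-- Two rows of three tiles, and a spare tile. -/
abbrev TwoRows := Option (Fin 2 × Fin 3)

/-- The rotation of the rows. -/
def rowShift (j : TwoRows) : TwoRows := j.map fun p => (p.1, p.2 + 1)

theorem rowMaps {a : Perm (Pt TwoRows)} (ha : ∀ j, Maps a (j, []) (rowShift j, []))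
    (j : TwoRows) (w : List Bool) : Maps a (j, w) (rowShift j, w) := (ha j).append w

/-- The cells exchanged by the involution. -/
def involutionCells (i : Fin 4 × Fin 2) : Cell TwoRows :=
  ![![(some (1, 0), [false]), (some (1, 0), [true])],
    ![(some (0, 0), []), (some (1, 2), [true])],
    ![(none, []), (some (1, 2), [false])],
    ![(some (0, 1), []), (some (1, 1), [])]] i.1 i.2

theorem involutionCells_apart :
    Pairwise fun i j => Apart (involutionCells i) (involutionCells j) := by
  unfold Pairwise
  decide

/-- The involution used together with an element of order three. -/
noncomputable def involution : Perm (Pt TwoRows) := rot involutionCells involutionCells_apart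

/-- Symbolic evaluation of the involution on cells of positive depth. -/
def involutionStep (c : Cell TwoRows) : Option (Cell TwoRows) :=
  if c.2 = [] then none else
    some (((List.finRange 4).flatMap (fun i => (List.finRange 2).filterMap fun k =>
      if (involutionCells (i, k)).1 = c.1 ∧ (involutionCells (i, k)).2 <+: c.2 then
        some (sub (involutionCells (i, k + 1)) (c.2.drop (involutionCells (i, k)).2.length))
      else none)).headD c)

theorem maps_involution_of_isPrefix {c : Cell TwoRows} {i : Fin 4} {k : Fin 2}
    (h : (involutionCells (i, k)).1 = c.1 ∧ (involutionCells (i, k)).2 <+: c.2) :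
    Maps involution c (sub (involutionCells (i, k + 1))
      (c.2.drop (involutionCells (i, k)).2.length)) := by
  obtain ⟨j, w⟩ := c
  obtain ⟨rfl, t, rfl⟩ := h
  have := (rot_maps (hF := involutionCells_apart) i k).sub t
  rw [finRotate_apply] at this
  change Maps (rot _ involutionCells_apart) _ _
  simpa [sub] using this

theorem maps_involutionStep {c d : Cell TwoRows} (h : involutionStep c = some d) :
    Maps involution c d := by
  unfold involutionStep at h
  split_ifs at h with hc
  rw [Option.some_inj] at h
  generalize hl : ((List.finRange 4).flatMap (fun i => (List.finRange 2).filterMap fun k =>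
      if (involutionCells (i, k)).1 = c.1 ∧ (involutionCells (i, k)).2 <+: c.2 then
        some (sub (involutionCells (i, k + 1)) (c.2.drop (involutionCells (i, k)).2.length))
      else none)) = l at h
  cases l with
  | nil =>
    obtain rfl : c = d := h
    refine rot_fixes fun i => apart_iff.2 fun e => ?_
    have h1 : ¬ (involutionCells i).2 <+: c.2 := fun h' => by
      have := List.eq_nil_iff_forall_not_mem.1 hl
        (sub (involutionCells (i.1, i.2 + 1)) (c.2.drop (involutionCells (i.1, i.2)).2.length))
      apply this
      simp only [List.mem_flatMap, List.mem_filterMap, List.mem_finRange, true_and]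
      exact ⟨i.1, i.2, if_pos ⟨e.symm, h'⟩⟩
    refine ⟨fun h' => h1 ?_, h1⟩
    have h2 : ∀ i, (involutionCells i).2.length ≤ 1 := by decide
    specialize h2 i
    have h3 := List.length_pos_of_ne_nil hc
    rw [h'.eq_of_length (by have := h'.length_le; omega)]
  | cons d' l =>
    obtain rfl : d' = d := h
    have : d' ∈ d' :: l := List.mem_cons_self
    rw [← hl] at this
    simp only [List.mem_flatMap, List.mem_filterMap, List.mem_finRange, true_and] at this
    obtain ⟨i, k, hik⟩ := this
    split_ifs at hik with h'
    rw [Option.some_inj] at hik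
    rw [← hik]
    exact maps_involution_of_isPrefix h'

/-- Symbolic evaluation of the involution times its conjugate. -/
def productStep (c : Cell TwoRows) : Option (Cell TwoRows) :=
  (involutionStep (rowShift (rowShift c.1), c.2)).bind fun d => involutionStep (rowShift d.1, d.2)

theorem rowShift_rowShift_rowShift (j : TwoRows) : rowShift (rowShift (rowShift j)) = j := by
  revert j
  decide

theorem maps_productStep {a : Perm (Pt TwoRows)} (ha : ∀ j, Maps a (j, []) (rowShift j, []))
    {c d : Cell TwoRows} (h : productStep c = some d) :
    Maps (involution * (a * involution * a⁻¹)) c d := by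
  obtain ⟨e, h1, h2⟩ := Option.bind_eq_some_iff.1 h
  have h3 := rowMaps ha (rowShift (rowShift c.1)) c.2
  rw [rowShift_rowShift_rowShift] at h3
  exact (maps_involutionStep h2).mul
    (((rowMaps ha e.1 e.2).mul (maps_involutionStep h1)).mul h3.inv)

/-- Iterated symbolic evaluation. -/
def productIter : ℕ → Cell TwoRows → Option (Cell TwoRows)
  | 0, c => some c
  | n + 1, c => (productStep c).bind (productIter n)

theorem maps_productIter {a : Perm (Pt TwoRows)} (ha : ∀ j, Maps a (j, []) (rowShift j, []))
    {n : ℕ} {c d : Cell TwoRows} (h : productIter n c = some d) :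
    Maps ((involution * (a * involution * a⁻¹)) ^ n) c d := by
  induction n generalizing c with
  | zero =>
    obtain rfl : c = d := Option.some_inj.1 h
    exact fun y => rfl
  | succ n ih =>
    obtain ⟨e, h1, h2⟩ := Option.bind_eq_some_iff.1 h
    rw [pow_succ]
    exact (ih h2).mul (maps_productStep ha h1)

theorem productIter_fst : ∀ b b' : Bool,
    productIter 14 (some (0, 0), [b, b']) = some (some (0, 2), [true, b, b']) := by
  decide +kernel

theorem productIter_snd : ∀ b : Bool,
    productIter 14 (some (0, 2), [true, b]) = some (some (1, 2), [true, b]) := by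
  decide +kernel

theorem productIter_trd : ∀ b : Bool,
    productIter 14 (some (1, 2), [true, b]) = some (some (0, 0), [b]) := by
  decide +kernel

theorem productIter_fixed : ∀ (j : TwoRows) (b b' : Bool),
    (j = some (0, 0) ∨ (j, b) = (some (0, 2), true) ∨ (j, b) = (some (1, 2), true)) ∨
    productIter 14 (j, [b, b']) = some (j, [b, b']) := by
  decide +kernel

theorem isTri_product {a : Perm (Pt TwoRows)} (ha : ∀ j, Maps a (j, []) (rowShift j, [])) :
    IsTri ((involution * (a * involution * a⁻¹)) ^ 14) (some (0, 0), []) (some (0, 2), [true])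
      (some (1, 2), [true]) := by
  refine ⟨maps_of_children fun b => maps_of_children fun b' => ?_,
    maps_of_children fun b => ?_, maps_of_children fun b => ?_, fun x h1 h2 h3 => ?_⟩
  · exact maps_productIter ha (productIter_fst b b')
  · exact maps_productIter ha (productIter_snd b)
  · exact maps_productIter ha (productIter_trd b)
  · obtain ⟨w, z, hw, hx⟩ := exists_place 2 x
    obtain ⟨b, b', rfl⟩ := List.length_eq_two.1 hw
    rw [hx]
    rcases productIter_fixed x.1 b b' with (e | e | e) | e
    · exact absurd (by rw [hx, e]; rfl) (h1 (word [b, b'] z))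
    · obtain ⟨e, rfl⟩ := Prod.ext_iff.1 e
      exact absurd (by rw [hx]; exact Prod.ext e rfl) (h2 (word [b'] z))
    · obtain ⟨e, rfl⟩ := Prod.ext_iff.1 e
      exact absurd (by rw [hx]; exact Prod.ext e rfl) (h3 (word [b'] z))
    · exact maps_productIter ha e z

theorem involution_maps (i : Fin 4) (k : Fin 2) :
    Maps involution (involutionCells (i, k)) (involutionCells (i, k + 1)) := by
  have := rot_maps (hF := involutionCells_apart) i k
  rwa [finRotate_apply] at this

theorem fst_injective_of_decide {J : Type} [DecidableEq J] {f : Fin 5 → Cell J}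
    (h : ∀ i j, (f i).1 = (f j).1 → i = j) : Function.Injective fun i => (f i).1 :=
  fun i j => h i j

/-- The involution and a rotation of the two rows generate all exchanges. -/
theorem swapGroup_le_of_involution {L : Subgroup (Perm (Pt TwoRows))} {a : Perm (Pt TwoRows)}
    (ha : ∀ j, Maps a (j, []) (rowShift j, [])) (haL : a ∈ L) (hx : involution ∈ L) :
    swapGroup TwoRows ≤ L := by
  have ra := fun j w => rowMaps ha j w
  have mA : ∀ w, Maps a (some (0, 0), w) (some (0, 1), w) := ra _
  have mB : ∀ w, Maps a (some (0, 1), w) (some (0, 2), w) := ra _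
  have mC : ∀ w, Maps a (some (0, 2), w) (some (0, 0), w) := ra _
  have mD : ∀ w, Maps a (some (1, 0), w) (some (1, 1), w) := ra _
  have mE : ∀ w, Maps a (some (1, 1), w) (some (1, 2), w) := ra _
  have mF : ∀ w, Maps a (some (1, 2), w) (some (1, 0), w) := ra _
  have mQ : ∀ w, Maps a (none, w) (none, w) := ra _
  have xD : Maps involution (some (1, 0), [false]) (some (1, 0), [true]) := involution_maps 0 0
  have xD' : Maps involution (some (1, 0), [true]) (some (1, 0), [false]) := involution_maps 0 1
  have xA : Maps involution (some (0, 0), []) (some (1, 2), [true]) := involution_maps 1 0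
  have xF : Maps involution (some (1, 2), [true]) (some (0, 0), []) := involution_maps 1 1
  have xQ : Maps involution (none, []) (some (1, 2), [false]) := involution_maps 2 0
  have xF' : Maps involution (some (1, 2), [false]) (none, []) := involution_maps 2 1
  have xB : Maps involution (some (0, 1), []) (some (1, 1), []) := involution_maps 3 0
  have xE : Maps involution (some (1, 1), []) (some (0, 1), []) := involution_maps 3 1
  have xC : Maps involution (some (0, 2), [true]) (some (0, 2), [true]) :=
    maps_involutionStep (by decide)
  have aL := L.inv_mem haL
  have T0m : (involution * (a * involution * a⁻¹)) ^ 14 ∈ L :=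
    L.pow_mem (L.mul_mem hx (L.mul_mem (L.mul_mem haL hx) aL)) 14
  have T0t := isTri_product ha
  have T0 : Tri L (some (0, 0), []) (some (0, 2), [true]) (some (1, 2), [true]) :=
    ⟨by decide, _, T0m, T0t⟩
  have T1 : Tri L (some (0, 1), []) (some (0, 0), [true]) (some (1, 0), [true]) :=
    T0.conj_mem haL (mA _) (mC _) (mF _)
  have T2 : Tri L (some (1, 1), []) (some (1, 2), [true, true]) (some (1, 0), [false]) :=
    T1.conj_mem hx xB (xA.append [true]) xD'
  have T3 : Tri L (some (0, 0), [true]) (some (1, 2), [true, true]) (some (0, 1), []) := by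
    obtain ⟨-, t, ht, T⟩ := T1
    generalize (involution * (a * involution * a⁻¹)) ^ 14 = s at T0m T0t
    have s' := T0t.inv
    have t' := T.inv
    refine ⟨by decide, _, L.mul_mem (L.mul_mem (L.mul_mem (L.inv_mem T0m) (L.inv_mem ht))
      (L.inv_mem (L.inv_mem T0m))) (L.inv_mem (L.inv_mem ht)),
      isTri_commutator (fun x => ?_) (s'.ab.append [true]) t'.rot.bc (by decide) (by decide)⟩
    by_cases h1 : ∃ y, x = place (some (0, 0), [true]) y
    · exact Or.inr (Or.inr h1)
    by_cases h2 : ∃ y, x = place (some (0, 1), []) y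
    · obtain ⟨y, rfl⟩ := h2
      exact Or.inl (s'.maps_of_apart (by decide) (by decide) (by decide) y)
    by_cases h3 : ∃ y, x = place (some (1, 0), [true]) y
    · obtain ⟨y, rfl⟩ := h3
      exact Or.inl (s'.maps_of_apart (by decide) (by decide) (by decide) y)
    push Not at h1 h2 h3
    exact Or.inr (Or.inl (t'.fix x h2 h3 h1))
  have A1 := alt_join T3.rot.rot T2.rot (by decide) (by decide) (by decide) (by decide)
  have T4 : Tri L (some (0, 0), []) (some (1, 0), []) (some (0, 2), [true]) :=
    (A1 0 4 1 (by decide) (by decide) (by decide)).conj_mem aL (mA _).inv (mD _).inv (mC _).inv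
  have T5 : Tri L (some (0, 2), [true]) (some (0, 0), []) (some (1, 2), [false]) :=
    (A1 1 0 3 (by decide) (by decide) (by decide)).conj_mem aL (mC _).inv (mA _).inv (mF _).inv
  have T6 : Tri L (some (0, 2), [true]) (some (1, 2), [true]) (none, []) :=
    T5.conj_mem hx xC xA xF'
  have hA := alt_join T4 T6 (by decide) (by decide) (by decide) (by decide)
  have T7 : Tri L (some (1, 2), [false]) (some (0, 1), []) (some (1, 1), []) :=
    ((hA 0 1 4 (by decide) (by decide) (by decide)).conj_mem haL (mA _) (mD _) (mQ _)).conj_mem hx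
      xB xE xQ |>.rot.rot.swap
  have A2 := alt_join T5 T7 (by decide) (by decide) (by decide) (by decide)
  generalize hf' : (![(some (0, 0), []), (some (1, 0), []), (some (0, 2), [true]),
    (some (1, 2), [true]), (none, [])] : Fin 5 → Cell TwoRows) = f at hA
  have hf : Function.Injective fun i => (f i).1 := by
    subst hf'
    exact fst_injective_of_decide (by decide)
  have gf := good_family hA
  have gA : Good L f (some (0, 0), []) := by simpa [← hf'] using gf 0
  have gD : Good L f (some (1, 0), []) := by simpa [← hf'] using gf 1
  have gC : Good L f (some (0, 2), [true]) := by simpa [← hf'] using gf 2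
  have gF : Good L f (some (1, 2), [true]) := by simpa [← hf'] using gf 3
  have gQ : Good L f (none, []) := by simpa [← hf'] using gf 4
  have gB : Good L f (some (0, 1), []) := by
    refine good_of_tri hA (k := 0) (l := 2) ?_ ?_ ?_ <;> subst hf'
    · decide
    · decide
    · exact A2 3 1 0 (by decide) (by decide) (by decide)
  have gE : Good L f (some (1, 1), []) := by
    refine good_of_tri hA (k := 0) (l := 2) ?_ ?_ ?_ <;> subst hf'
    · decide
    · decide
    · exact A2 4 1 0 (by decide) (by decide) (by decide)
  have cx : Carrier L f involution := by
    refine ⟨hx, ![0, 2, 3], by decide, fun i => ?_⟩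
    subst hf'
    fin_cases i
    · exact ⟨_, xA, gF⟩
    · exact ⟨_, xC, gC⟩
    · exact ⟨_, xF, gA⟩
  have ca : Carrier L f a := by
    refine ⟨haL, ![0, 1, 4], by decide, fun i => ?_⟩
    subst hf'
    fin_cases i
    · exact ⟨_, mA _, gB⟩
    · exact ⟨_, mD _, gE⟩
    · exact ⟨_, mQ _, gQ⟩
  have tx : ∀ {c d}, Maps involution c d → Good L f c → Good L f d := fun h g =>
    g.transport hf hA cx h
  have ta : ∀ {c d}, Maps a c d → Good L f c → Good L f d := fun h g => g.transport hf hA ca h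
  have key : ∀ w, Good L f (some (1, 0), w) := by
    intro w
    induction w with
    | nil => exact gD
    | cons b w ih =>
      have h1 : Good L f (some (1, 0), true :: w) :=
        ta (mF _) (tx (xA.append w) (ta (mC _) (ta (mB _) (tx (xE.append w) (ta (mD _) ih)))))
      cases b
      · exact tx (xD'.append w) h1
      · exact h1
  refine swapGroup_le_of_good hf 0 fun c _ => ?_
  obtain ⟨j, w⟩ := c
  have hE := ta (mD _) (key w)
  have hB := tx (xE.append w) hE
  have hC := ta (mB _) hB
  rcases j with _ | ⟨r, e⟩
  · exact tx (xF'.append w) (ta (mE _) (ta (mD _) (key (false :: w))))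
  · fin_cases r <;> fin_cases e
    · exact ta (mC _) hC
    · exact hB
    · exact hC
    · exact key w
    · exact hE
    · exact ta (mE _) hE

/-! ### Comb codes -/

/-- The `n + 1` words `1, 01, …, 0ⁿ⁻¹1, 0ⁿ` of the comb code. -/
def comb : ℕ → ℕ → List Bool
  | 0, _ => []
  | _ + 1, 0 => [true]
  | n + 1, k + 1 => false :: comb n k

theorem eq_of_isPrefix_comb {n k l : ℕ} (hk : k ≤ n) (hl : l ≤ n) (h : comb n k <+: comb n l) :
    k = l := by
  induction n generalizing k l with
  | zero => omega
  | succ n ih =>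
    rcases k with _ | k <;> rcases l with _ | l
    · rfl
    · simp [comb] at h
    · simp [comb] at h
    · simp only [comb, List.cons_prefix_cons, true_and] at h
      rw [ih (by omega) (by omega) h]

theorem exists_comb_append {n : ℕ} {w : List Bool} (h : n ≤ w.length) :
    ∃ k ≤ n, ∃ v, w = comb n k ++ v := by
  induction n generalizing w with
  | zero => exact ⟨0, le_rfl, w, rfl⟩
  | succ n ih =>
    rcases w with _ | ⟨b, w⟩
    · simp at h
    · cases b
      · obtain ⟨k, hk, v, rfl⟩ := ih (Nat.le_of_succ_le_succ h)
        exact ⟨k + 1, by omega, v, rfl⟩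
      · exact ⟨0, by omega, w, rfl⟩

theorem apart_comb {j : J} {n k l : ℕ} (hk : k ≤ n) (hl : l ≤ n) (h : k ≠ l) :
    Apart ((j, comb n k) : Cell J) (j, comb n l) :=
  apart_iff.2 fun _ => ⟨fun h' => h (eq_of_isPrefix_comb hk hl h'),
    fun h' => h (eq_of_isPrefix_comb hl hk h').symm⟩

theorem forall_of_finRotate {p : ℕ} (hp : 2 ≤ p) {P : Fin p → Prop}
    (h : ∀ k, P k → P (finRotate p k)) {k : Fin p} (hk : P k) (l : Fin p) : P l := by
  obtain ⟨n, rfl⟩ := Nat.exists_eq_add_of_le' hp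
  have hs : ∀ k : Fin (n + 2), finRotate (n + 2) k ≠ k := fun k => by
    rw [← Perm.mem_support, support_finRotate]
    exact Finset.mem_univ k
  obtain ⟨i, -, rfl⟩ := (isCycle_finRotate.sameCycle (hs k) (hs l)).exists_pow_eq'
  clear hs
  induction i with
  | zero => exact hk
  | succ i ih =>
    rw [pow_succ', Perm.mul_apply]
    exact h _ ih

/-! ### Rotations of the tiling with two rows -/

/-- The position in the comb code of the `k`-th cell of a cycle. -/
def combIndex (k : ℕ) : ℕ := if k = 1 then 0 else k - 2

/-- The three cycles of cells: four of the tiles and the halves of a fifth one are linked by a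
comb code in the spare tile. -/
def rowsCells (p : ℕ) (i : Fin 3 × Fin p) : Cell TwoRows :=
  if (i.2 : ℕ) = 0 then ![(some (0, 1), []), (some (1, 1), []), (some (1, 2), [])] i.1
  else if (i.2 : ℕ) = 2 then
    ![(some (1, 0), []), (some (0, 2), [false]), (some (0, 2), [true])] i.1
  else (none, comb (3 * (p - 2) - 1) (i.1 * (p - 2) + combIndex i.2))

theorem rowsCells_index_le {p : ℕ} (hp : 4 ≤ p) (r : Fin 3) {k : ℕ} (hk : k < p) :
    r * (p - 2) + combIndex k ≤ 3 * (p - 2) - 1 := by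
  have : (r : ℕ) * (p - 2) ≤ 2 * (p - 2) := Nat.mul_le_mul_right _ (by omega)
  unfold combIndex
  split_ifs <;> omega

theorem rowsCells_apart {p : ℕ} (hp : 4 ≤ p) :
    Pairwise fun i j => Apart (rowsCells p i) (rowsCells p j) := by
  rintro ⟨r, k, hk⟩ ⟨s, l, hl⟩ hne
  have h1 := rowsCells_index_le hp r hk
  have h2 := rowsCells_index_le hp s hl
  have d1 : ∀ r s : Fin 3, r ≠ s → Apart
      ((![(some (0, 1), []), (some (1, 1), []), (some (1, 2), [])] : Fin 3 → Cell TwoRows) r)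
      ((![(some (0, 1), []), (some (1, 1), []), (some (1, 2), [])] : Fin 3 → Cell TwoRows) s) := by
    decide
  have d2 : ∀ r s : Fin 3, r ≠ s → Apart
      ((![(some (1, 0), []), (some (0, 2), [false]), (some (0, 2), [true])] :
        Fin 3 → Cell TwoRows) r)
      ((![(some (1, 0), []), (some (0, 2), [false]), (some (0, 2), [true])] :
        Fin 3 → Cell TwoRows) s) := by
    decide
  have d3 : ∀ r s : Fin 3, Apart
      ((![(some (0, 1), []), (some (1, 1), []), (some (1, 2), [])] : Fin 3 → Cell TwoRows) r)
      ((![(some (1, 0), []), (some (0, 2), [false]), (some (0, 2), [true])] :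
        Fin 3 → Cell TwoRows) s) := by
    decide
  have d4 : ∀ r : Fin 3,
      ((![(some (0, 1), []), (some (1, 1), []), (some (1, 2), [])] :
        Fin 3 → Cell TwoRows) r).1 ≠ none := by
    decide
  have d5 : ∀ r : Fin 3,
      ((![(some (1, 0), []), (some (0, 2), [false]), (some (0, 2), [true])] :
        Fin 3 → Cell TwoRows) r).1 ≠ none := by
    decide
  have hrs : k = l → r ≠ s := fun e1 e2 => hne (by subst e1 e2; rfl)
  dsimp only [rowsCells]
  split_ifs with a1 a2 a3 a4 a5 a6 a7 a8
  · exact d1 r s (hrs (by omega))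
  · exact d3 r s
  · exact apart_of_fst_ne (d4 r)
  · exact (d3 s r).symm
  · exact d2 r s (hrs (by omega))
  · exact apart_of_fst_ne (d5 r)
  · exact apart_of_fst_ne (d4 s).symm
  · exact apart_of_fst_ne (d5 s).symm
  · refine apart_comb h1 h2 fun e => ?_
    have h3 : (r : ℕ) = s := by
      obtain ⟨m, rfl⟩ : ∃ m, p = m + 2 := ⟨p - 2, by omega⟩
      have c1 : combIndex k < m := by unfold combIndex; split_ifs <;> omega
      have c2 : combIndex l < m := by unfold combIndex; split_ifs <;> omega
      have e1 := congrArg (· / m) e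
      simp only [Nat.add_sub_cancel] at e1
      rwa [Nat.mul_comm, Nat.mul_add_div (by omega), Nat.div_eq_of_lt c1, Nat.mul_comm (s : ℕ),
        Nat.mul_add_div (by omega), Nat.div_eq_of_lt c2] at e1
    rw [h3, Nat.add_left_cancel_iff] at e
    refine hrs ?_ (Fin.ext h3)
    unfold combIndex at e
    split_ifs at e <;> omega

/-- The element of order `p ≥ 4` used together with an element of order three. -/
noncomputable def rowsRot {p : ℕ} (hp : 4 ≤ p) : Perm (Pt TwoRows) :=
  rot (rowsCells p) (rowsCells_apart hp)

theorem finRotate_mk {p k : ℕ} (h : k + 1 < p) :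
    finRotate p ⟨k, by omega⟩ = ⟨k + 1, h⟩ := by
  obtain ⟨n, rfl⟩ := Nat.exists_eq_add_of_le' (show 1 ≤ p by omega)
  exact finRotate_of_lt (by omega)

theorem finRotate_last_mk {p : ℕ} (h : 0 < p) :
    finRotate p ⟨p - 1, by omega⟩ = ⟨0, h⟩ := by
  obtain ⟨n, rfl⟩ := Nat.exists_eq_add_of_le' h
  exact finRotate_last

theorem swapGroup_le_of_rowsRot {p : ℕ} (hp : 4 ≤ p) {L : Subgroup (Perm (Pt TwoRows))}
    {a : Perm (Pt TwoRows)}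
    (ha : ∀ j, Maps a (j, []) (rowShift j, [])) (haL : a ∈ L) (hx : rowsRot hp ∈ L) :
    swapGroup TwoRows ≤ L := by
  have ra := fun j w => rowMaps ha j w
  have mA : ∀ w, Maps a (some (0, 0), w) (some (0, 1), w) := ra _
  have mB : ∀ w, Maps a (some (0, 1), w) (some (0, 2), w) := ra _
  have mC : ∀ w, Maps a (some (0, 2), w) (some (0, 0), w) := ra _
  have mD : ∀ w, Maps a (some (1, 0), w) (some (1, 1), w) := ra _
  have mE : ∀ w, Maps a (some (1, 1), w) (some (1, 2), w) := ra _
  have mF : ∀ w, Maps a (some (1, 2), w) (some (1, 0), w) := ra _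
  have mQ : ∀ w, Maps a (none, w) (none, w) := ra _
  have xm : ∀ r k, Maps (rowsRot hp) (rowsCells p (r, k)) (rowsCells p (r, finRotate p k)) :=
    fun r k => rot_maps r k
  have x01 : ∀ r, Maps (rowsRot hp) (rowsCells p (r, ⟨0, by omega⟩))
      (rowsCells p (r, ⟨1, by omega⟩)) := fun r => by
    have := xm r ⟨0, by omega⟩
    rwa [finRotate_mk (by omega)] at this
  have x12 : ∀ r, Maps (rowsRot hp) (rowsCells p (r, ⟨1, by omega⟩))
      (rowsCells p (r, ⟨2, by omega⟩)) := fun r => by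
    have := xm r ⟨1, by omega⟩
    rwa [finRotate_mk (by omega)] at this
  have xl : ∀ r, Maps (rowsRot hp) (rowsCells p (r, ⟨p - 1, by omega⟩))
      (rowsCells p (r, ⟨0, by omega⟩)) := fun r => by
    have := xm r ⟨p - 1, by omega⟩
    rwa [finRotate_last_mk (by omega)] at this
  have cl : ∀ r, (rowsCells p (r, ⟨p - 1, by omega⟩)).1 = none := fun r => by
    rw [rowsCells, if_neg (by dsimp only; omega), if_neg (by dsimp only; omega)]
  have c1 : ∀ r, (rowsCells p (r, ⟨1, by omega⟩)).1 = none := fun r => rfl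
  have q0 : rowsCells p (0, ⟨1, by omega⟩) = (none, [true]) := by
    obtain ⟨m, hm⟩ : ∃ m, 3 * (p - 2) - 1 = m + 1 := ⟨3 * (p - 2) - 2, by omega⟩
    change (none, comb (3 * (p - 2) - 1) (0 * (p - 2) + combIndex 1)) = _
    rw [hm, Nat.zero_mul]
    rfl
  have xA : Maps (rowsRot hp) (some (0, 0), []) (some (0, 0), []) := by
    refine rot_fixes fun ⟨r, k⟩ => apart_of_fst_ne ?_
    dsimp only [rowsCells]
    split_ifs
    · revert r
      decide
    · revert r
      decide
    · simp
  have xB : Maps (rowsRot hp) (some (0, 1), []) (none, [true]) := q0 ▸ x01 0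
  have xq : Maps (rowsRot hp) (none, [true]) (some (1, 0), []) := q0 ▸ x12 0
  have aQ : ∀ x : Pt TwoRows, x.1 = none → a x = x := fun x hx => by
    obtain ⟨w, z, -, h⟩ := exists_place 0 x
    rw [h, hx]
    exact mQ w z
  have T0 : Tri L (some (0, 0), []) (some (0, 1), []) (none, [true]) := by
    refine ⟨by decide, _, L.mul_mem (L.mul_mem (L.mul_mem haL
      (L.mul_mem (L.mul_mem hx haL) (L.inv_mem hx))) (L.inv_mem haL))
      (L.inv_mem (L.mul_mem (L.mul_mem hx haL) (L.inv_mem hx))),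
      isTri_commutator (fun x => ?_) (mA []) ((xB.mul (mA [])).mul xA.inv)
      (by decide) (by decide)⟩
    have hn : ∀ d : Cell TwoRows, (∃ c : Cell TwoRows, c.1 = none ∧ Maps (rowsRot hp) c d) →
        ∀ y, (rowsRot hp * a * (rowsRot hp)⁻¹) (place d y) = place d y := by
      rintro d ⟨c, hc, h⟩ y
      rw [Perm.mul_apply, Perm.mul_apply, h.inv y, aQ _ hc, h]
    obtain ⟨w, z, hw, hxw⟩ := exists_place 1 x
    obtain ⟨j, y⟩ := x
    rcases j with _ | ⟨r, e⟩
    · exact Or.inl (aQ _ rfl)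
    · obtain ⟨b, rfl⟩ := List.length_eq_one_iff.1 hw
      fin_cases r <;> fin_cases e
      · exact Or.inr (Or.inr ⟨y, rfl⟩)
      · exact Or.inr (Or.inl (hn (some (0, 1), []) ⟨_, cl 0, xl 0⟩ y))
      · rw [hxw]
        cases b
        · exact Or.inr (Or.inl (hn (some (0, 2), [false]) ⟨_, c1 1, x12 1⟩ z))
        · exact Or.inr (Or.inl (hn (some (0, 2), [true]) ⟨_, c1 2, x12 2⟩ z))
      · exact Or.inr (Or.inl (hn (some (1, 0), []) ⟨_, c1 0, x12 0⟩ y))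
      · exact Or.inr (Or.inl (hn (some (1, 1), []) ⟨_, cl 1, xl 1⟩ y))
      · exact Or.inr (Or.inl (hn (some (1, 2), []) ⟨_, cl 2, xl 2⟩ y))
  have T1 : Tri L (some (0, 0), []) (none, [true]) (some (1, 0), []) :=
    T0.conj_mem hx xA xB xq
  have T2 : Tri L (some (0, 1), []) (some (0, 2), []) (none, [true]) :=
    T0.conj_mem haL (mA _) (mB _) (mQ _)
  have hA := alt_join T2 T1.rot (by decide) (by decide) (by decide) (by decide)
  generalize hf' : (![(some (0, 1), []), (some (0, 2), []), (none, [true]),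
    (some (1, 0), []), (some (0, 0), [])] : Fin 5 → Cell TwoRows) = f at hA
  have hf : Function.Injective fun i => (f i).1 := by
    subst hf'
    exact fst_injective_of_decide (by decide)
  have gf := good_family hA
  have gB : Good L f (some (0, 1), []) := by simpa [← hf'] using gf 0
  have gC : Good L f (some (0, 2), []) := by simpa [← hf'] using gf 1
  have gq : Good L f (none, [true]) := by simpa [← hf'] using gf 2
  have gD : Good L f (some (1, 0), []) := by simpa [← hf'] using gf 3
  have gA : Good L f (some (0, 0), []) := by simpa [← hf'] using gf 4
  have cx : Carrier L f (rowsRot hp) := by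
    refine ⟨hx, ![0, 2, 4], by decide, fun i => ?_⟩
    subst hf'
    fin_cases i
    · exact ⟨_, xB, gq⟩
    · exact ⟨_, xq, gD⟩
    · exact ⟨_, xA, gA⟩
  have ca : Carrier L f a := by
    refine ⟨haL, ![4, 0, 2], by decide, fun i => ?_⟩
    subst hf'
    fin_cases i
    · exact ⟨_, mA _, gB⟩
    · exact ⟨_, mB _, gC⟩
    · exact ⟨_, mQ _, gq⟩
  have ta : ∀ {c d}, Maps a c d → Good L f c → Good L f d := fun h g => g.transport hf hA ca h
  have tx : ∀ {r k} l {w}, Good L f (sub (rowsCells p (r, k)) w) →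
      Good L f (sub (rowsCells p (r, l)) w) := fun {r} _ l {w} g =>
    forall_of_finRotate (by omega) (P := fun l => Good L f (sub (rowsCells p (r, l)) w))
      (fun l h => h.transport hf hA cx ((xm r l).sub w)) g l
  have x0 : ∀ {r w}, Good L f (sub (rowsCells p (r, ⟨0, by omega⟩)) w) →
      ∀ k, Good L f (sub (rowsCells p (r, k)) w) := fun h k => tx k h
  have key : ∀ w, Good L f (some (1, 0), w) := by
    intro w
    induction w with
    | nil => exact gD
    | cons b w ih =>
      refine x0 (r := 0) (w := b :: w) (ta (mA _) (ta (mC _) ?_)) ⟨2, by omega⟩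
      cases b
      · exact x0 (r := 1) (w := w) (ta (mD _) ih) ⟨2, by omega⟩
      · exact x0 (r := 2) (w := w) (ta (mE _) (ta (mD _) ih)) ⟨2, by omega⟩
  have hB : ∀ w, Good L f (some (0, 1), w) := fun w =>
    tx (r := 0) (k := ⟨2, by omega⟩) (w := w) ⟨0, by omega⟩ (key w)
  refine swapGroup_le_of_good hf (3 * (p - 2) - 1) fun c hc => ?_
  obtain ⟨j, w⟩ := c
  rcases j with _ | ⟨r, e⟩
  · obtain ⟨k, hk, v, rfl⟩ := exists_comb_append hc
    obtain ⟨r, m, hm, rfl⟩ : ∃ (r : Fin 3) (m : ℕ), m < p - 2 ∧ k = r * (p - 2) + m := by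
      refine ⟨⟨k / (p - 2), ?_⟩, k % (p - 2), Nat.mod_lt _ (by omega), ?_⟩
      · rw [Nat.div_lt_iff_lt_mul (by omega)]
        omega
      · rw [Nat.mul_comm]
        exact (Nat.div_add_mod _ _).symm
    obtain ⟨l, hl, h0, h2, rfl⟩ : ∃ l, l < p ∧ l ≠ 0 ∧ l ≠ 2 ∧ m = combIndex l := by
      rcases Nat.eq_zero_or_pos m with rfl | h
      · exact ⟨1, by omega, by omega, by omega, rfl⟩
      · exact ⟨m + 2, by omega, by omega, by omega, by simp [combIndex]⟩
    have h : Good L f (sub (rowsCells p (r, ⟨0, by omega⟩)) v) := by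
      fin_cases r
      · exact hB v
      · exact ta (mD _) (key v)
      · exact ta (mE _) (ta (mD _) (key v))
    have h' := x0 h ⟨l, hl⟩
    rwa [rowsCells, if_neg h0, if_neg h2] at h'
  · fin_cases r <;> fin_cases e
    · exact ta (mC _) (ta (mB _) (hB w))
    · exact hB w
    · exact ta (mB _) (hB w)
    · exact key w
    · exact ta (mD _) (key w)
    · exact ta (mE _) (ta (mD _) (key w))

/-! ### Two permutations moving tiles along a square -/

/-- The permutations `c` and `d` fix the tile `t 0`, move the tile `t 1` to `t 2` and `t 3`, move
both of these to `t 4`, and move the tile `t 1` to all tiles other than `t 0`. -/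
structure IsSquare (t : Fin 5 → J) (c d : Perm (Pt J)) : Prop where
  inj : Function.Injective t
  c0 : Maps c (t 0, []) (t 0, [])
  c1 : Maps c (t 1, []) (t 2, [])
  c2 : ∃ j, j ≠ t 0 ∧ j ≠ t 2 ∧ j ≠ t 3 ∧ j ≠ t 4 ∧ Maps c (t 2, []) (j, [])
  c3 : Maps c (t 3, []) (t 4, [])
  d0 : Maps d (t 0, []) (t 0, [])
  d1 : Maps d (t 1, []) (t 3, [])
  d2 : Maps d (t 2, []) (t 4, [])
  reach : ∀ P : J → Prop, P (t 1) →
    (∀ i j, (Maps c (i, []) (j, []) ∨ Maps d (i, []) (j, [])) → P i → P j) → ∀ j, j ≠ t 0 → P j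

theorem IsSquare.ne {t : Fin 5 → J} {c d : Perm (Pt J)} (H : IsSquare t c d) {i j : Fin 5}
    (h : i ≠ j) : t i ≠ t j := fun e => h (H.inj e)

theorem IsSquare.good_of_one {t : Fin 5 → J} {c d : Perm (Pt J)} (H : IsSquare t c d)
    {L : Subgroup (Perm (Pt J))} {f : Fin 5 → Cell J}
    (hf : Function.Injective fun i => (f i).1) (hA : Alt L f) (hc : Carrier L f c)
    (hd : Carrier L f d) {n : ℕ} (h1 : ∀ w, n ≤ w.length → Good L f (t 1, w)) (j : J)
    (hj : j ≠ t 0) (w : List Bool) (hw : n ≤ w.length) : Good L f (j, w) := by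
  revert w hw
  revert j
  refine H.reach _ h1 fun i j h hi w hw => ?_
  rcases h with h | h
  · exact (hi w hw).transport hf hA hc (h.append w)
  · exact (hi w hw).transport hf hA hd (h.append w)

theorem apart_comb_append {j : J} {n k l : ℕ} (hk : k ≤ n) (hl : l ≤ n) (h : k ≠ l)
    (v w : List Bool) : Apart ((j, comb n k ++ v) : Cell J) (j, comb n l ++ w) :=
  ((apart_comb hk hl h).sub_left v).sub_right w

/-- Two cycles of cells in three tiles. -/
def squareCells (κ σ δ : J) (p : ℕ) (i : Fin 2 × Fin p) : Cell J :=
  if i.1 = 0 then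
    if (i.2 : ℕ) = 0 then (κ, [])
    else if (i.2 : ℕ) = 1 then (σ, comb (p - 2) (p - 2) ++ [])
    else if (i.2 : ℕ) = 2 then (δ, comb (p - 2) 0 ++ [])
    else (σ, comb (p - 2) (i.2 - 2) ++ [])
  else
    if (i.2 : ℕ) = 0 then (δ, comb (p - 2) (p - 2) ++ [])
    else if (i.2 : ℕ) = 1 then (σ, comb (p - 2) 0 ++ [false])
    else if (i.2 : ℕ) = 2 then (σ, comb (p - 2) 0 ++ [true])
    else (δ, comb (p - 2) (i.2 - 2) ++ [])

theorem squareCells_apart {κ σ δ : J} {p : ℕ} (hp : 3 ≤ p) (h1 : κ ≠ σ) (h2 : κ ≠ δ)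
    (h3 : σ ≠ δ) : Pairwise fun i j => Apart (squareCells κ σ δ p i) (squareCells κ σ δ p j) := by
  rintro ⟨r, k, hk⟩ ⟨s, l, hl⟩ hne
  have hrs : r = s → k ≠ l := fun e1 e2 => hne (by subst e1 e2; rfl)
  have h4 : Apart ((σ, comb (p - 2) 0 ++ [false]) : Cell J) (σ, comb (p - 2) 0 ++ [true]) :=
    apart_sub_sub (σ, comb (p - 2) 0) (by decide)
  have hr : r = 0 ∨ r = 1 := by omega
  have hs : s = 0 ∨ s = 1 := by omega
  rcases hr with rfl | rfl <;> rcases hs with rfl | rfl <;> dsimp only [squareCells] <;>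
    split_ifs <;>
    first
      | omega
      | exact apart_of_fst_ne h1
      | exact apart_of_fst_ne h1.symm
      | exact apart_of_fst_ne h2
      | exact apart_of_fst_ne h2.symm
      | exact apart_of_fst_ne h3
      | exact apart_of_fst_ne h3.symm
      | exact h4
      | exact h4.symm
      | exact apart_comb_append (by omega) (by omega) (by omega) _ _

theorem squareCells_fst (κ σ δ : J) (p : ℕ) (i : Fin 2 × Fin p) :
    (squareCells κ σ δ p i).1 = κ ∨ (squareCells κ σ δ p i).1 = σ ∨
      (squareCells κ σ δ p i).1 = δ := by
  unfold squareCells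
  split_ifs <;> simp

section IsSquare

variable {t : Fin 5 → J} {c d : Perm (Pt J)} {L : Subgroup (Perm (Pt J))}

/-- The tile `t 0` and translates of the cell `(t 1, u)`. -/
def squareFamily (t : Fin 5 → J) (u : List Bool) : Fin 5 → Cell J :=
  ![(t 1, u), (t 2, u), (t 0, []), (t 3, u), (t 4, u)]

theorem squareFamily_injective (ht : Function.Injective t) (u : List Bool) :
    Function.Injective fun i => (squareFamily t u i).1 := by
  have : (fun i => (squareFamily t u i).1) = fun i => t (![1, 2, 0, 3, 4] i) := by
    funext i
    fin_cases i <;> rfl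
  rw [this]
  exact ht.comp (g := t) (by decide)

theorem IsSquare.carrier_c (H : IsSquare t c d) {u : List Bool} (hA : Alt L (squareFamily t u))
    (hc : c ∈ L) : Carrier L (squareFamily t u) c := by
  refine ⟨hc, ![2, 0, 3], by decide, fun i => ?_⟩
  fin_cases i
  · exact ⟨_, H.c0, good_family hA 2⟩
  · exact ⟨_, H.c1.append u, good_family hA 1⟩
  · exact ⟨_, H.c3.append u, good_family hA 4⟩

theorem IsSquare.carrier_d (H : IsSquare t c d) {u : List Bool} (hA : Alt L (squareFamily t u))
    (hd : d ∈ L) : Carrier L (squareFamily t u) d := by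
  refine ⟨hd, ![2, 0, 1], by decide, fun i => ?_⟩
  fin_cases i
  · exact ⟨_, H.d0, good_family hA 2⟩
  · exact ⟨_, H.d1.append u, good_family hA 3⟩
  · exact ⟨_, H.d2.append u, good_family hA 4⟩

theorem IsSquare.carrier_d_inv (H : IsSquare t c d) {u : List Bool}
    (hA : Alt L (squareFamily t u)) (hd : d ∈ L) : Carrier L (squareFamily t u) d⁻¹ := by
  refine ⟨L.inv_mem hd, ![2, 3, 4], by decide, fun i => ?_⟩
  fin_cases i
  · exact ⟨_, H.d0.inv, good_family hA 2⟩
  · exact ⟨_, (H.d1.append u).inv, good_family hA 0⟩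
  · exact ⟨_, (H.d2.append u).inv, good_family hA 1⟩

/-- The element of order `p ≥ 3` used together with a square. -/
noncomputable def squareRot (ht : Function.Injective t) {p : ℕ} (hp : 3 ≤ p) : Perm (Pt J) :=
  rot (squareCells (t 0) (t 1) (t 3) p)
    (squareCells_apart hp (ht.ne (by decide)) (ht.ne (by decide)) (ht.ne (by decide)))

theorem IsSquare.maps_squareCells (H : IsSquare t c d) {p : ℕ} (i : Fin 2 × Fin p) :
    Maps c (squareCells (t 0) (t 1) (t 3) p i) (squareCells (t 0) (t 2) (t 4) p i) := by
  unfold squareCells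
  split_ifs
  · exact H.c0
  all_goals first | exact H.c1.append _ | exact H.c3.append _

theorem IsSquare.swapGroup_le_of_squareRot (H : IsSquare t c d) (hcL : c ∈ L) (hdL : d ∈ L)
    {p : ℕ} (hp : 3 ≤ p) (hx : squareRot H.inj hp ∈ L) : swapGroup J ≤ L := by
  have xm : ∀ r k, Maps (squareRot H.inj hp) (squareCells (t 0) (t 1) (t 3) p (r, k))
      (squareCells (t 0) (t 1) (t 3) p (r, finRotate p k)) := fun r k => rot_maps r k
  obtain ⟨u, hu⟩ : ∃ u, u = comb (p - 2) (p - 2) := ⟨_, rfl⟩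
  have s1 : squareCells (t 0) (t 1) (t 3) p (0, ⟨1, by omega⟩) = (t 1, u) := by
    simp [squareCells, hu]
  have s0 : squareCells (t 0) (t 1) (t 3) p (0, ⟨0, by omega⟩) = (t 0, []) := by
    simp [squareCells]
  have x0 : Maps (squareRot H.inj hp) (t 0, []) (t 1, u) := by
    have := xm 0 ⟨0, by omega⟩
    rwa [finRotate_mk (by omega), s0, s1] at this
  have xf : ∀ j, j ≠ t 0 → j ≠ t 1 → j ≠ t 3 → ∀ y, squareRot H.inj hp (j, y) = (j, y) :=
    fun j h0 h1 h3 y => by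
      refine act_fix_of_fst _ fun i => ?_
      rcases squareCells_fst (t 0) (t 1) (t 3) p i with e | e | e <;> rw [e] <;> assumption
  have cf : ∀ x : Pt J, x.1 ≠ t 0 → x.1 ≠ t 2 → x.1 ≠ t 4 →
      (c * squareRot H.inj hp * c⁻¹) x = x := fun x h0 h2 h4 => by
    rw [squareRot, rot, act_conj (fun i => H.maps_squareCells i) (hF' := squareCells_apart hp
      (H.ne (by decide)) (H.ne (by decide)) (H.ne (by decide)))]
    refine act_fix_of_fst _ fun i => ?_
    rcases squareCells_fst (t 0) (t 2) (t 4) p i with e | e | e <;> rw [e] <;> assumption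
  have T0 : Tri L (t 0, []) (t 1, u) (t 2, u) := by
    refine ⟨⟨apart_of_fst_ne (H.ne (by decide)), apart_of_fst_ne (H.ne (by decide)),
      apart_of_fst_ne (H.ne (by decide))⟩, _, L.mul_mem (L.mul_mem (L.mul_mem hx
      (L.mul_mem (L.mul_mem hcL hx) (L.inv_mem hcL))) (L.inv_mem hx))
      (L.inv_mem (L.mul_mem (L.mul_mem hcL hx) (L.inv_mem hcL))),
      isTri_commutator (fun x => ?_) x0 (((H.c1.append u).mul x0).mul H.c0.inv)
      (apart_of_fst_ne (H.ne (by decide))) (apart_of_fst_ne (H.ne (by decide)))⟩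
    obtain ⟨j, y⟩ := x
    by_cases h0 : j = t 0
    · subst h0
      exact Or.inr (Or.inr ⟨y, rfl⟩)
    by_cases h1 : j = t 1
    · exact Or.inr (Or.inl (cf _ h0 (h1 ▸ H.ne (by decide)) (h1 ▸ H.ne (by decide))))
    by_cases h3 : j = t 3
    · exact Or.inr (Or.inl (cf _ h0 (h3 ▸ H.ne (by decide)) (h3 ▸ H.ne (by decide))))
    exact Or.inl (xf j h0 h1 h3 y)
  have T1 : Tri L (t 0, []) (t 3, u) (t 4, u) :=
    T0.conj_mem hdL H.d0 (H.d1.append u) (H.d2.append u)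
  have hA : Alt L (squareFamily t u) := alt_join T0.rot T1
    (apart_of_fst_ne (H.ne (by decide))) (apart_of_fst_ne (H.ne (by decide)))
    (apart_of_fst_ne (H.ne (by decide))) (apart_of_fst_ne (H.ne (by decide)))
  have hf := squareFamily_injective H.inj u
  have gf := good_family hA
  have cc := H.carrier_c hA hcL
  have cd := H.carrier_d hA hdL
  have cd' := H.carrier_d_inv hA hdL
  have xm' : ∀ k, k ≠ 0 → k ≠ 1 → k ≠ 3 → Maps (squareRot H.inj hp) (t k, u) (t k, u) :=
    fun k h0 h1 h3 y => xf _ (H.ne h0) (H.ne h1) (H.ne h3) _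
  have g0 : Good L (squareFamily t u) (t 0, []) := gf 2
  have cx : Carrier L (squareFamily t u) (squareRot H.inj hp) := by
    refine ⟨hx, ![2, 1, 4], by decide, fun i => ?_⟩
    fin_cases i
    · exact ⟨_, x0, gf 0⟩
    · exact ⟨_, xm' 2 (by decide) (by decide) (by decide), gf 1⟩
    · exact ⟨_, xm' 4 (by decide) (by decide) (by decide), gf 4⟩
  generalize squareFamily t u = f at hA hf gf g0 cc cd cd' cx
  have tx : ∀ {r k} l {w}, Good L f (sub (squareCells (t 0) (t 1) (t 3) p (r, k)) w) →
      Good L f (sub (squareCells (t 0) (t 1) (t 3) p (r, l)) w) := fun {r} _ l {w} g =>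
    forall_of_finRotate (by omega)
      (P := fun l => Good L f (sub (squareCells (t 0) (t 1) (t 3) p (r, l)) w))
      (fun l h => h.transport hf hA cx ((xm r l).sub w)) g l
  have spread : ∀ {k w}, Good L f (sub (squareCells (t 0) (t 1) (t 3) p (0, k)) w) →
      ∀ l ≤ p - 2, Good L f (t 1, comb (p - 2) l ++ w) := fun {k w} h l hl => by
    rcases Nat.eq_zero_or_pos l with rfl | h0
    · have := tx (r := 0) ⟨2, by omega⟩ h
      simp only [squareCells, sub, if_true, List.append_nil] at this
      exact this.transport hf hA cd' (H.d1.append _).inv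
    · rcases hl.eq_or_lt with rfl | h1
      · have := tx (r := 0) ⟨1, by omega⟩ h
        simpa [squareCells, sub] using this
      · have := tx (r := 0) ⟨l + 2, by omega⟩ h
        simpa [squareCells, sub, h0.ne'] using this
  have key : ∀ w, ∀ l ≤ p - 2, Good L f (t 1, comb (p - 2) l ++ w) := by
    intro w
    induction w with
    | nil =>
      refine spread (k := ⟨0, by omega⟩) ?_
      rw [s0]
      exact g0
    | cons b w ih =>
      have h1 : Good L f (sub (squareCells (t 0) (t 1) (t 3) p (1, ⟨0, by omega⟩)) w) := by
        have := (ih (p - 2) le_rfl).transport hf hA cd (H.d1.append _)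
        simpa [squareCells, sub] using this
      have h2 : Good L f (t 1, comb (p - 2) 0 ++ b :: w) := by
        cases b
        · have := tx ⟨1, by omega⟩ h1
          simpa [squareCells, sub] using this
        · have := tx ⟨2, by omega⟩ h1
          simpa [squareCells, sub] using this
      refine spread (k := ⟨2, by omega⟩) ?_
      have := h2.transport hf hA cd (H.d1.append _)
      simpa [squareCells, sub] using this
  have h1 : ∀ w : List Bool, p - 2 ≤ w.length → Good L f (t 1, w) := fun w hw => by
    obtain ⟨k, hk, v, rfl⟩ := exists_comb_append hw
    exact key v k hk
  refine swapGroup_le_of_good hf (p - 2) fun ⟨j, w⟩ hw => ?_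
  by_cases hj : j = t 0
  · have h2 : Good L f (sub (squareCells (t 0) (t 1) (t 3) p (0, ⟨1, by omega⟩)) w) := by
      rw [s1, hu]
      exact key w _ le_rfl
    have := tx ⟨0, by omega⟩ h2
    rw [s0] at this
    rw [hj]
    exact this
  · exact H.good_of_one hf hA cc cd h1 j hj w hw

theorem Apart.map_fst {K : Type} {t : K → J} (ht : Function.Injective t) {a b : Cell K}
    (h : Apart a b) : Apart ((t a.1, a.2) : Cell J) (t b.1, b.2) :=
  apart_iff.2 fun e => (apart_iff (c := a)).1 h (ht e)

theorem act_fst_eq {ι : Type} {F : ι → Cell J} {hF : Pairwise fun i j => Apart (F i) (F j)}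
    {σ : Perm ι} {j : J} (h : ∀ i, (F i).1 = j → (F (σ i)).1 = j) (x : Pt J) (hx : x.1 = j) :
    (act F hF σ x).1 = j := by
  by_cases hi : ∃ i y, x = place (F i) y
  · obtain ⟨i, y, rfl⟩ := hi
    rw [act_maps σ i y]
    exact h i hx
  · push Not at hi
    rw [act_fix σ hi, hx]

/-- The cells exchanged by the involution used together with a square, up to the labelling of
the tiles. -/
def squareLabels (i : Fin 6 × Fin 2) : Cell (Fin 5) :=
  ![![(0, []), (1, [false, false, false, false])],
    ![(1, [false, false, false, true]), (1, [true, true])],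
    ![(1, [false, false, true]), (1, [false, true])],
    ![(2, [false, false]), (1, [true, false])],
    ![(3, [false, false, false]), (3, [false, true])],
    ![(3, [false, false, true]), (3, [true, false])]] i.1 i.2

/-- The cells exchanged by the involution used together with a square. -/
def squareInvCells (t : Fin 5 → J) (i : Fin 6 × Fin 2) : Cell J :=
  (t (squareLabels i).1, (squareLabels i).2)

theorem squareInvCells_apart (ht : Function.Injective t) :
    Pairwise fun i j => Apart (squareInvCells t i) (squareInvCells t j) := by
  have : Pairwise fun i j => Apart (squareLabels i) (squareLabels j) := by
    unfold Pairwise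
    decide +kernel
  exact fun i j hij => (this hij).map_fst ht

/-- The involution used together with a square. -/
noncomputable def squareInv (ht : Function.Injective t) : Perm (Pt J) :=
  rot (squareInvCells t) (squareInvCells_apart ht)

theorem squareInv_maps (ht : Function.Injective t) (i : Fin 6) (k : Fin 2) :
    Maps (squareInv ht) (squareInvCells t (i, k)) (squareInvCells t (i, k + 1)) := by
  have := rot_maps (hF := squareInvCells_apart ht) i k
  rwa [finRotate_apply] at this

theorem squareInv_inv (ht : Function.Injective t) : (squareInv ht)⁻¹ = squareInv ht := by
  rw [inv_eq_iff_mul_eq_one, ← sq]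
  have := pow_orderOf_eq_one (squareInv ht)
  rwa [squareInv, orderOf_rot le_rfl] at this

theorem squareInv_fix (ht : Function.Injective t) {j : J} (h0 : j ≠ t 0) (h1 : j ≠ t 1)
    (h2 : j ≠ t 2) (h3 : j ≠ t 3) (x : Pt J) (hx : x.1 = j) : squareInv ht x = x := by
  refine act_fix_of_fst _ fun i => ?_
  have : ∀ i, (squareLabels i).1 = 0 ∨ (squareLabels i).1 = 1 ∨ (squareLabels i).1 = 2 ∨
      (squareLabels i).1 = 3 := by
    decide
  unfold squareInvCells
  rw [hx]
  rcases this i with e | e | e | e <;> rw [e] <;> assumption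

theorem squareInv_three (ht : Function.Injective t) (x : Pt J) (hx : x.1 = t 3) :
    (squareInv ht x).1 = t 3 := by
  refine act_fst_eq (fun i h => ?_) x hx
  have : ∀ i : Fin 6 × Fin 2, (squareLabels i).1 = 3 →
      (squareLabels (rotHom (Fin 6) 2 (finRotate 2) i)).1 = 3 := by
    decide
  exact congrArg t (this i (ht h))

theorem squareInv_two (ht : Function.Injective t) (x : Pt J) (hx : x.1 = t 2) :
    squareInv ht x = x ∨ ∃ z, squareInv ht x = place (t 1, [true, false]) z := by
  by_cases hi : ∃ i y, x = place (squareInvCells t i) y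
  · obtain ⟨i, y, rfl⟩ := hi
    have : ∀ i : Fin 6 × Fin 2, (squareLabels i).1 = 2 → i = (3, 0) := by
      decide
    obtain rfl := this i (ht hx)
    exact Or.inr ⟨y, squareInv_maps ht 3 0 y⟩
  · push Not at hi
    exact Or.inl (act_fix _ hi)

theorem squareInv_fixes (ht : Function.Injective t) (a : Cell (Fin 5))
    (ha : ∀ i, Apart a (squareLabels i)) :
    Maps (squareInv ht) (t a.1, a.2) (t a.1, a.2) :=
  rot_fixes fun i => (ha i).map_fst ht

/-- The commutator of the involution and its conjugate moves the points of three tiles only. -/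
theorem IsSquare.commutator_fix (H : IsSquare t c d) (x : Pt J) (h0 : x.1 ≠ t 0) (h1 : x.1 ≠ t 1)
    (h2 : x.1 ≠ t 2) : (squareInv H.inj * (c * squareInv H.inj * c⁻¹) * (squareInv H.inj)⁻¹ *
      (c * squareInv H.inj * c⁻¹)⁻¹) x = x := by
  have hc : ∀ {i j}, Maps c (i, []) (j, []) → ∀ x : Pt J, x.1 = j → (c⁻¹ x).1 = i :=
    fun {i j} h x hx => by
      obtain ⟨w, z, hw, h'⟩ := exists_place 0 x
      obtain rfl := List.length_eq_zero_iff.1 hw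
      rw [h', hx, h.inv z]
      rfl
  have hc' : ∀ {i j}, Maps c (i, []) (j, []) → ∀ x : Pt J, x.1 = i → (c x).1 = j :=
    fun {i j} h x hx => by
      obtain ⟨w, z, hw, h'⟩ := exists_place 0 x
      obtain rfl := List.length_eq_zero_iff.1 hw
      rw [h', hx, h z]
      rfl
  obtain ⟨j, j0, j2, j3, j4, hj⟩ := H.c2
  have inv := squareInv_inv H.inj
  have fix := fun {j} => squareInv_fix H.inj (j := j)
  have three := squareInv_three H.inj
  have two := squareInv_two H.inj
  have f10 : Maps (squareInv H.inj) (t 2, [true, false]) (t 2, [true, false]) :=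
    squareInv_fixes H.inj (2, [true, false]) (by decide)
  have sq : ∀ x, squareInv H.inj (squareInv H.inj x) = x := fun x => by
    nth_rewrite 1 [← inv]
    exact inv_apply _ _
  rw [mul_inv_rev, mul_inv_rev, inv_inv, inv]
  generalize squareInv H.inj = α at *
  simp only [Perm.mul_apply]
  have β3 : ∀ x : Pt J, x.1 = t 3 → c (α (c⁻¹ x)) = x := fun x hx => by
    rw [fix (j := (c⁻¹ x).1) ?_ ?_ ?_ ?_ _ rfl, apply_inv]
    all_goals
      intro e
    · rw [← apply_inv c x, hc' H.c0 _ e] at hx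
      exact H.ne (by decide) hx
    · rw [← apply_inv c x, hc' H.c1 _ e] at hx
      exact H.ne (by decide) hx
    · rw [← apply_inv c x, hc' hj _ e] at hx
      exact j3 hx
    · rw [← apply_inv c x, hc' H.c3 _ e] at hx
      exact H.ne (by decide) hx
  by_cases h3 : x.1 = t 3
  · rw [β3 x h3, β3 _ (three x h3), sq]
  have hα : α x = x := fix h0 h1 h2 h3 x rfl
  suffices h : α (c (α (c⁻¹ x))) = c (α (c⁻¹ x)) by
    rw [h, inv_apply, sq, apply_inv, hα]
  by_cases h4 : x.1 = t 4
  · have : (c (α (c⁻¹ x))).1 = t 4 := hc' H.c3 _ (three _ (hc H.c3 _ h4))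
    exact fix (H.ne (by decide)) (H.ne (by decide)) (H.ne (by decide)) (H.ne (by decide)) _ this
  by_cases hx : x.1 = j
  · rcases two _ (hc hj x hx) with e | ⟨z, e⟩
    · rw [e, apply_inv, hα]
    · have h5 : c (place (t 1, [true, false]) z) = place (t 2, [true, false]) z :=
        H.c1.append [true, false] z
      rw [e, h5]
      exact f10 z
  · rw [fix (j := (c⁻¹ x).1) ?_ ?_ ?_ ?_ _ rfl, apply_inv, hα]
    all_goals
      intro e
    · rw [← apply_inv c x, hc' H.c0 _ e] at h0
      exact h0 rfl
    · rw [← apply_inv c x, hc' H.c1 _ e] at h2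
      exact h2 rfl
    · rw [← apply_inv c x, hc' hj _ e] at hx
      exact hx rfl
    · rw [← apply_inv c x, hc' H.c3 _ e] at h4
      exact h4 rfl

theorem IsSquare.carrier_c_inv (H : IsSquare t c d) {u : List Bool}
    (hA : Alt L (squareFamily t u)) (hc : c ∈ L) : Carrier L (squareFamily t u) c⁻¹ := by
  refine ⟨L.inv_mem hc, ![2, 1, 4], by decide, fun i => ?_⟩
  fin_cases i
  · exact ⟨_, H.c0.inv, good_family hA 2⟩
  · exact ⟨_, (H.c1.append u).inv, good_family hA 0⟩
  · exact ⟨_, (H.c3.append u).inv, good_family hA 3⟩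

theorem IsSquare.swapGroup_le_of_squareInv (H : IsSquare t c d) (hcL : c ∈ L) (hdL : d ∈ L)
    (hx : squareInv H.inj ∈ L) : swapGroup J ≤ L := by
  have xm := squareInv_maps H.inj
  obtain ⟨u, hu⟩ : ∃ u, u = [false, false, false, false] := ⟨_, rfl⟩
  have xK : Maps (squareInv H.inj) (t 0, []) (t 1, u) := hu ▸ xm 0 0
  have xS : Maps (squareInv H.inj) (t 1, u) (t 0, []) := hu ▸ xm 0 1
  have T1 : Tri L (t 0, []) (t 2, u) (t 4, u) := by
    have hcx := L.mul_mem (L.mul_mem hcL hx) (L.inv_mem hcL)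
    have hT := L.mul_mem (L.mul_mem (L.mul_mem hx hcx) (L.inv_mem hx)) (L.inv_mem hcx)
    have hfix := H.commutator_fix
    have hm : Maps (squareInv H.inj * (c * squareInv H.inj * c⁻¹) * (squareInv H.inj)⁻¹ *
        (c * squareInv H.inj * c⁻¹)⁻¹) (t 0, []) (t 2, u) := by
      rw [mul_inv_rev, mul_inv_rev, inv_inv, squareInv_inv]
      have h1 : Maps (c * (squareInv H.inj * c⁻¹)) (t 0, []) (t 2, u) :=
        (H.c1.append u).mul (xK.mul H.c0.inv)
      have h2 : Maps (squareInv H.inj) (t 2, u) (t 1, [true, false, false, false]) := by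
        rw [hu]
        exact (xm 3 0).append [false, false]
      have h3 : Maps (squareInv H.inj) (t 1, [true, false, false, false]) (t 2, u) := by
        rw [hu]
        exact (xm 3 1).append [false, false]
      have h5 : Maps (c * squareInv H.inj * c⁻¹) (t 1, [true, false, false, false])
        (t 1, [true, false, false, false]) := by
        obtain ⟨j, j0, j2, j3, j4, hj⟩ := H.c2
        by_cases h1 : j = t 1
        · subst h1
          have f10 : Maps (squareInv H.inj) (t 2, [true, false, false, false])
              (t 2, [true, false, false, false]) :=
            squareInv_fixes H.inj (2, [true, false, false, false]) (by decide)
          exact ((hj.append _).mul f10).mul (hj.append _).inv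
        · intro y
          have hn : ∀ {i k}, Maps c (i, []) (k, []) → k ≠ t 1 →
              (c⁻¹ (place (t 1, [true, false, false, false]) y)).1 ≠ i := fun {i k} h hk e => by
            obtain ⟨w, z, hw, h'⟩ :=
              exists_place 0 (c⁻¹ (place (t 1, [true, false, false, false]) y))
            obtain rfl := List.length_eq_zero_iff.1 hw
            rw [e, Perm.inv_eq_iff_eq, h z] at h'
            exact hk (Prod.ext_iff.1 h').1.symm
          rw [Perm.mul_apply, Perm.mul_apply, squareInv_fix H.inj (hn H.c0 (H.ne (by decide)))
            (hn H.c1 (H.ne (by decide))) (hn hj h1) (hn H.c3 (H.ne (by decide))) _ rfl, apply_inv]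
      exact ((h3.mul h5).mul h2).mul h1
    generalize squareInv H.inj * (c * squareInv H.inj * c⁻¹) * (squareInv H.inj)⁻¹ *
        (c * squareInv H.inj * c⁻¹)⁻¹ = T at hT hfix hm
    have hd : ∀ {i j}, Maps d (i, []) (j, []) → ∀ x : Pt J, (d⁻¹ x).1 = i → x.1 = j :=
      fun {i j} h x hx => by
        obtain ⟨w, z, hw, h'⟩ := exists_place 0 (d⁻¹ x)
        obtain rfl := List.length_eq_zero_iff.1 hw
        rw [← apply_inv d x, h', hx, h z]
        rfl
    have hdT := L.mul_mem (L.mul_mem hdL hT) (L.inv_mem hdL)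
    refine ⟨⟨apart_of_fst_ne (H.ne (by decide)), apart_of_fst_ne (H.ne (by decide)),
      apart_of_fst_ne (H.ne (by decide))⟩, _, L.mul_mem (L.mul_mem (L.mul_mem hT hdT)
      (L.inv_mem hT)) (L.inv_mem hdT),
      isTri_commutator (fun x => ?_) hm (((H.d2.append u).mul hm).mul H.d0.inv)
      (apart_of_fst_ne (H.ne (by decide))) (apart_of_fst_ne (H.ne (by decide)))⟩
    by_cases h0 : x.1 = t 0
    · obtain ⟨j, y⟩ := x
      obtain rfl : j = t 0 := h0
      exact Or.inr (Or.inr ⟨y, rfl⟩)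
    by_cases h1 : x.1 = t 1 ∨ x.1 = t 2
    · refine Or.inr (Or.inl ?_)
      rw [Perm.mul_apply, Perm.mul_apply, hfix, apply_inv] <;> intro e
      · exact h0 (hd H.d0 x e)
      · have := hd H.d1 x e
        rw [this] at h1
        exact h1.elim (H.ne (by decide)) (H.ne (by decide))
      · have := hd H.d2 x e
        rw [this] at h1
        exact h1.elim (H.ne (by decide)) (H.ne (by decide))
    · push Not at h1
      exact Or.inl (hfix x h0 h1.1 h1.2)
  have T2 : Tri L (t 0, []) (t 1, u) (t 3, u) :=
    T1.conj_mem (L.inv_mem hcL) H.c0.inv (H.c1.append u).inv (H.c3.append u).inv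
  have hA : Alt L (squareFamily t u) := by
    have := alt_join T2.rot T1
      (apart_of_fst_ne (H.ne (by decide))) (apart_of_fst_ne (H.ne (by decide)))
      (apart_of_fst_ne (H.ne (by decide))) (apart_of_fst_ne (H.ne (by decide)))
    have e : squareFamily t u = fun i => ![(t 1, u), (t 3, u), (t 0, []), (t 2, u), (t 4, u)]
        ((![0, 3, 2, 1, 4] : Fin 5 → Fin 5) i) := by
      funext i
      fin_cases i <;> rfl
    have hi : Function.Injective (![0, 3, 2, 1, 4] : Fin 5 → Fin 5) := by decide
    rw [e]
    exact fun i j k h1 h2 h3 => this _ _ _ (hi.ne h1) (hi.ne h2) (hi.ne h3)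
  have hf := squareFamily_injective H.inj u
  have gf := good_family hA
  have cc := H.carrier_c hA hcL
  have cc' := H.carrier_c_inv hA hcL
  have cd := H.carrier_d hA hdL
  have cd' := H.carrier_d_inv hA hdL
  have x4 : Maps (squareInv H.inj) (t 4, u) (t 4, u) := fun y =>
    squareInv_fix H.inj (H.ne (by decide)) (H.ne (by decide)) (H.ne (by decide))
      (H.ne (by decide)) _ rfl
  have cx : Carrier L (squareFamily t u) (squareInv H.inj) := by
    refine ⟨hx, ![2, 0, 4], by decide, fun i => ?_⟩
    fin_cases i
    · exact ⟨_, xK, gf 0⟩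
    · exact ⟨_, xS, gf 2⟩
    · exact ⟨_, x4, gf 4⟩
  have g0 : Good L (squareFamily t u) (t 1, u) := gf 0
  generalize squareFamily t u = f at hA hf g0 cc cc' cd cd' cx
  have ec : ∀ w, Good L f (t 1, w) ↔ Good L f (t 2, w) := fun w =>
    ⟨fun h => h.transport hf hA cc (H.c1.append w), fun h =>
      h.transport hf hA cc' (H.c1.append w).inv⟩
  have ed : ∀ w, Good L f (t 1, w) ↔ Good L f (t 3, w) := fun w =>
    ⟨fun h => h.transport hf hA cd (H.d1.append w), fun h =>
      h.transport hf hA cd' (H.d1.append w).inv⟩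
  have ex : ∀ i w, Good L f (sub (squareInvCells t (i, 0)) w) ↔
      Good L f (sub (squareInvCells t (i, 1)) w) := fun i w =>
    ⟨fun h => h.transport hf hA cx ((xm i 0).sub w), fun h =>
      h.transport hf hA cx ((xm i 1).sub w)⟩
  have e0 : ∀ w, Good L f (t 0, w) ↔ Good L f (t 1, false :: false :: false :: false :: w) := ex 0
  have e1 : ∀ w, Good L f (t 1, false :: false :: false :: true :: w) ↔
    Good L f (t 1, true :: true :: w) := ex 1
  have e2 : ∀ w, Good L f (t 1, false :: false :: true :: w) ↔
    Good L f (t 1, false :: true :: w) := ex 2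
  have e3 : ∀ w, Good L f (t 2, false :: false :: w) ↔
    Good L f (t 1, true :: false :: w) := ex 3
  have e4 : ∀ w, Good L f (t 3, false :: false :: false :: w) ↔
    Good L f (t 3, false :: true :: w) := ex 4
  have e5 : ∀ w, Good L f (t 3, false :: false :: true :: w) ↔
    Good L f (t 3, true :: false :: w) := ex 5
  simp only [← ec, ← ed] at e3 e4 e5
  have k1 : ∀ w, Good L f (t 1, false :: false :: w) ↔
      Good L f (t 1, false :: false :: false :: w) := fun w => by
    rw [e3, ← e5, e2, e4]
  have k2 : ∀ w, Good L f (t 1, false :: false :: w) := fun w => by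
    induction w with
    | nil => rwa [k1, k1, ← hu]
    | cons b w ih =>
      cases b
      · rwa [← k1]
      · rwa [e5, ← e3]
  have h1 : ∀ w : List Bool, 2 ≤ w.length → Good L f (t 1, w) := by
    rintro (_ | ⟨b, _ | ⟨b', w⟩⟩) hw
    · simp at hw
    · simp at hw
    · cases b <;> cases b'
      · exact k2 w
      · rw [← e2]
        exact k2 _
      · rw [← e3]
        exact k2 _
      · rw [← e1]
        exact k2 _
  refine swapGroup_le_of_good hf 2 fun ⟨j, w⟩ hw => ?_
  by_cases hj : j = t 0
  · rw [hj, e0]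
    exact k2 _
  · exact H.good_of_one hf hA cc cd h1 j hj w hw

end IsSquare

theorem exists_simple_of_hom {G : Type} [Group G] [Nontrivial G] (φ : G →* Perm (Pt J))
    (hJ : ∀ s : List J, s.length ≤ 4 → ∃ j, j ∉ s)
    (hk : ∀ g, ∃ u ∈ swapGroup J, ∃ v ∈ swapGroup J,
      φ g = (u * φ g * u⁻¹) * (v * φ g * v⁻¹))
    (hd : ∀ g, g ≠ 1 → ∃ c : Cell J, ∀ y z, φ g (place c y) ≠ place c z)
    (hp : ∀ p : ℕ, (p = 0 ∨ 2 ≤ p) → ∃ x ∈ φ.range ⊔ swapGroup J, orderOf x = p ∧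
      (∀ L : Subgroup (Perm (Pt J)), φ.range ≤ L → x ∈ L → swapGroup J ≤ L) ∧
      ∀ k, x ^ k ≠ 1 → ∀ N : Subgroup (Perm (Pt J)),
        (∀ v ∈ swapGroup J, ∀ n ∈ N, v * n * v⁻¹ ∈ N) → x ^ k ∈ N → swapGroup J ≤ N) :
    ∃ (S : Type) (_ : Group S), IsSimpleGroup S ∧ ∃ φ : G →* S, Function.Injective φ ∧
      ∀ p : ℕ, (p = 0 ∨ 2 ≤ p) →
        ∃ x : S, orderOf x = p ∧ Subgroup.closure (Set.range φ ∪ {x}) = ⊤ := by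
  obtain ⟨Γ, hΓ⟩ : ∃ Γ, Γ = φ.range ⊔ swapGroup J := ⟨_, rfl⟩
  rw [← hΓ] at hp
  have hφΓ : ∀ g, φ g ∈ Γ := fun g => hΓ ▸ Subgroup.mem_sup_left ⟨g, rfl⟩
  have hVΓ : swapGroup J ≤ Γ := hΓ ▸ le_sup_right
  have up : ∀ N : Subgroup Γ, N.Normal → ∀ v ∈ swapGroup J, ∀ n ∈ N.map Γ.subtype,
      v * n * v⁻¹ ∈ N.map Γ.subtype := by
    rintro N hN v hv _ ⟨n, hn, rfl⟩
    exact ⟨_, hN.conj_mem n hn ⟨v, hVΓ hv⟩, rfl⟩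
  have down : ∀ N : Subgroup Γ, swapGroup J ≤ N.map Γ.subtype → (swapGroup J).subgroupOf Γ ≤ N := by
    rintro N h v hv
    obtain ⟨n, hn, e⟩ := h hv
    rwa [← Subtype.ext e]
  have gen : ∀ K : Subgroup Γ, (∀ g, (⟨φ g, hφΓ g⟩ : Γ) ∈ K) →
      (swapGroup J).subgroupOf Γ ≤ K → K = ⊤ := by
    intro K h1 h2
    have : Γ ≤ K.map Γ.subtype := by
      conv_lhs => rw [hΓ]
      refine sup_le ?_ fun v hv => ?_
      · rintro _ ⟨g, rfl⟩
        exact ⟨_, h1 g, rfl⟩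
      · exact ⟨⟨v, hVΓ hv⟩, h2 hv, rfl⟩
    refine eq_top_iff.2 fun x _ => ?_
    obtain ⟨n, hn, e⟩ := this x.2
    rwa [← Subtype.ext e]
  refine exists_simple_quotient ((swapGroup J).subgroupOf Γ)
    (φ.codRestrict Γ hφΓ) ?_ ?_ ?_ fun p h => ?_
  · intro g hg N hN hgN
    obtain ⟨c, hc⟩ := hd g hg
    exact down N (swapGroup_le_of_displaces hJ (up N hN) ⟨_, hgN, rfl⟩ hc)
  · rw [injective_iff_map_eq_one]
    intro g hg
    by_contra h
    obtain ⟨c, hc⟩ := hd g h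
    have : φ g = 1 := congrArg Subtype.val hg
    exact hc (0, 0) (0, 0) (by rw [this]; rfl)
  · intro N hN hV
    refine gen N (fun g => ?_) hV
    obtain ⟨u, hu, v, hv, e⟩ := hk g
    have e' : (⟨φ g, hφΓ g⟩ : Γ) = (⟨u, hVΓ hu⟩ * ⟨φ g, hφΓ g⟩ * ⟨u, hVΓ hu⟩⁻¹) *
        (⟨v, hVΓ hv⟩ * ⟨φ g, hφΓ g⟩ * ⟨v, hVΓ hv⟩⁻¹) := Subtype.ext e
    have e'' := congrArg (QuotientGroup.mk' N) e'
    have hu' : QuotientGroup.mk' N ⟨u, hVΓ hu⟩ = 1 := (QuotientGroup.eq_one_iff _).2 (hV hu)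
    have hv' : QuotientGroup.mk' N ⟨v, hVΓ hv⟩ = 1 := (QuotientGroup.eq_one_iff _).2 (hV hv)
    simp only [map_mul, map_inv, hu', hv', one_mul, inv_one, mul_one, left_eq_mul] at e''
    exact (QuotientGroup.eq_one_iff _).1 e''
  · obtain ⟨x, hx, h1, h2, h3⟩ := hp p h
    refine ⟨⟨x, hx⟩, by rw [← h1, Subgroup.orderOf_mk], ?_, fun k hk N hN hxN => ?_⟩
    · have m : ∀ g, (⟨φ g, hφΓ g⟩ : Γ) ∈
          Subgroup.closure (Set.range (φ.codRestrict Γ hφΓ) ∪ {⟨x, hx⟩}) := fun g =>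
        Subgroup.subset_closure (Or.inl ⟨g, rfl⟩)
      refine gen _ m (down _ (h2 _ ?_ ?_))
      · rintro _ ⟨g, rfl⟩
        exact ⟨_, m g, rfl⟩
      · exact ⟨⟨x, hx⟩, Subgroup.subset_closure (Or.inr rfl), rfl⟩
    · exact down N (h3 k (fun e => hk (Subtype.ext e)) _ (up N hN) ⟨_, hxN, rfl⟩)

theorem swapGroup_le_of_conj (hJ : ∀ s : List J, s.length ≤ 4 → ∃ j, j ∉ s)
    {B L : Subgroup (Perm (Pt J))} {x : Perm (Pt J)} (hx : x * x = 1) (hB : B ≤ L)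
    (hBx : ∀ b ∈ B, x * b * x⁻¹ ∈ L)
    (hV : ∀ K : Subgroup (Perm (Pt J)), B ≤ K → x ∈ K → swapGroup J ≤ K)
    {b : Perm (Pt J)} (hb : b ∈ B) {c : Cell J} (hc : ∀ y z, b (place c y) ≠ place c z) :
    swapGroup J ≤ L := by
  obtain ⟨K, hK⟩ : ∃ K, K = B ⊔ B.map (MulAut.conj x).toMonoidHom := ⟨_, rfl⟩
  have hBK : B ≤ K := hK ▸ le_sup_left
  have hxK : ∀ n ∈ K, x * n * x⁻¹ ∈ K := by
    have : K ≤ K.comap (MulAut.conj x).toMonoidHom := by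
      conv_lhs => rw [hK]
      refine sup_le (fun b hb => ?_) ?_
      · rw [hK]
        exact Subgroup.mem_sup_right ⟨b, hb, rfl⟩
      · rintro _ ⟨b, hb, rfl⟩
        have e : (MulAut.conj x).toMonoidHom ((MulAut.conj x).toMonoidHom b) = b := by
          change x * (x * b * x⁻¹) * x⁻¹ = b
          rw [← inv_eq_of_mul_eq_one_right hx]
          group
          simp [zpow_ofNat, sq, hx, mul_assoc]
        rw [Subgroup.mem_comap, e]
        exact hBK hb
    exact fun n hn => this hn
  have hN : swapGroup J ≤ Subgroup.normalizer (K : Set (Perm (Pt J))) := by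
    refine hV _ (hBK.trans Subgroup.le_normalizer) ?_
    rw [Subgroup.mem_normalizer_iff]
    refine fun n => ⟨hxK n, fun h => ?_⟩
    have := hxK _ h
    have e : x * (x * n * x⁻¹) * x⁻¹ = (x * x) * n * (x * x)⁻¹ := by group
    rw [e, hx] at this
    simpa using this
  refine (swapGroup_le_of_displaces hJ (fun v hv n hn => ?_) (hBK hb) hc).trans ?_
  · exact (Subgroup.mem_normalizer_iff.1 (hN hv) n).1 hn
  · rw [hK]
    refine sup_le hB ?_
    rintro _ ⟨b, hb, rfl⟩
    exact hBx b hb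

/-- A product of two exchanges, shrinking a cell of the given tile. -/
theorem exists_shrink (κ : J) : ∃ z ∈ swapGroup J, (∀ p : Pt J, p.1 ≠ κ → z p = p) ∧
    Maps z (κ, [false]) (κ, [false, false]) := by
  have h1 : Apart ((κ, [false]) : Cell J) (κ, [true]) := apart_children (κ, [])
  have h2 : Apart ((κ, [false]) : Cell J) (κ, [true, false]) := h1.sub_right [false]
  obtain ⟨s, hs, S⟩ := exists_isSwap h1
  obtain ⟨t, ht, T⟩ := exists_isSwap h2
  refine ⟨s * t, mul_mem hs ht, fun p hp => ?_, (S.ba.append [false]).mul T.ab⟩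
  have hne : ∀ w y, p ≠ place (κ, w) y := fun w y e => hp (by rw [e]; rfl)
  rw [Perm.mul_apply, T.fix p (hne _) (hne _), S.fix p (hne _) (hne _)]

theorem tile_of_fix {κ : J} {z : Perm (Pt J)} (hz : ∀ p : Pt J, p.1 ≠ κ → z p = p) {p : Pt J}
    (hp : p.1 = κ) : (z p).1 = κ := by
  by_contra h
  have := z.injective (hz _ h)
  rw [this] at h
  exact h hp

theorem commute_of_fix {κ : J} {g z : Perm (Pt J)} (hg : Maps g (κ, []) (κ, []))
    (hz : ∀ p : Pt J, p.1 ≠ κ → z p = p) : Commute g z := by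
  have hg' : ∀ p : Pt J, p.1 = κ → g p = p := by
    rintro ⟨_, y⟩ rfl
    exact hg y
  ext1 p
  rw [Perm.mul_apply, Perm.mul_apply]
  by_cases hp : p.1 = κ
  · rw [hg' p hp, hg' _ (tile_of_fix hz hp)]
  · rw [hz p hp, hz]
    intro h
    have := hg' _ h
    rw [g.injective this] at h
    exact hp h

theorem pow_displaces {κ : J} {x z : Perm (Pt J)} {e : Cell J} (hx : x * x = 1)
    (hxe : Maps x (κ, []) e) (he : e.1 ≠ κ) (hz : ∀ p : Pt J, p.1 ≠ κ → z p = p)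
    (hz' : Maps z (κ, [false]) (κ, [false, false])) {n : ℕ} (hn : n ≠ 0) :
    ∃ c : Cell J, ∀ y y', ((x * z) ^ n) (place c y) ≠ place c y' := by
  have hsq : ∀ p : Pt J, p.1 = κ → ((x * z) ^ 2) p = z p := by
    intro p hp
    have h1 : (x (z p)).1 ≠ κ := by
      have : z p = place (κ, []) (z p).2 := Prod.ext (tile_of_fix hz hp) rfl
      rw [this, hxe]
      exact he
    rw [sq, Perm.mul_apply, Perm.mul_apply, Perm.mul_apply, hz _ h1, ← Perm.mul_apply, hx,
      Perm.one_apply]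
  have hev : ∀ k w, Maps ((x * z) ^ (2 * k)) (κ, false :: w)
      (κ, false :: (List.replicate k false ++ w)) := by
    intro k w
    induction k with
    | zero => exact fun y => rfl
    | succ k ih =>
      rw [Nat.mul_succ, Nat.add_comm, pow_add]
      intro y
      rw [Perm.mul_apply, ih, hsq _ rfl]
      exact hz'.append (List.replicate k false ++ w) y
  rcases Nat.even_or_odd' n with ⟨k, rfl | rfl⟩
  · refine ⟨(κ, [false, true]), fun y y' => ?_⟩
    rw [hev k [true] y]
    obtain ⟨m, rfl⟩ := Nat.exists_eq_succ_of_ne_zero (show k ≠ 0 by omega)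
    refine (apart_iff.2 fun _ => ?_) y y'
    simp [List.replicate_succ]
  · refine ⟨(κ, [false]), fun y y' h => he ?_⟩
    rw [pow_succ', Perm.mul_apply, hev k [] y] at h
    have h2 := hz'.append (List.replicate k false) y
    rw [Perm.mul_apply, List.append_nil] at h
    have h3 : z (place (κ, false :: List.replicate k false) y) = _ := h2
    have h4 := hxe.append ([false, false] ++ List.replicate k false) y
    rw [h3] at h
    exact congrArg Prod.fst (h4.symm.trans h)

theorem exists_infinite_order {G : Type} [Group G] [Nontrivial G] (φ : G →* Perm (Pt J))
    (hJ : ∀ s : List J, s.length ≤ 4 → ∃ j, j ∉ s)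
    (hd : ∀ g, g ≠ 1 → ∃ c : Cell J, ∀ y z, φ g (place c y) ≠ place c z) {κ : J}
    (hκ : ∀ g, Maps (φ g) (κ, []) (κ, []))
    {x : Perm (Pt J)} (hx : x * x = 1) (hxV : x ∈ swapGroup J) {e : Cell J}
    (hxe : Maps x (κ, []) e) (he : e.1 ≠ κ)
    (hxL : ∀ L : Subgroup (Perm (Pt J)), φ.range ≤ L → x ∈ L → swapGroup J ≤ L) :
    ∃ x ∈ φ.range ⊔ swapGroup J, orderOf x = 0 ∧
      (∀ L : Subgroup (Perm (Pt J)), φ.range ≤ L → x ∈ L → swapGroup J ≤ L) ∧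
      ∀ k, x ^ k ≠ 1 → ∀ N : Subgroup (Perm (Pt J)),
        (∀ v ∈ swapGroup J, ∀ n ∈ N, v * n * v⁻¹ ∈ N) → x ^ k ∈ N → swapGroup J ≤ N := by
  obtain ⟨z, hzV, hz, hz'⟩ := exists_shrink κ
  have hpow := fun n (hn : n ≠ 0) => pow_displaces hx hxe he hz hz' hn
  refine ⟨x * z, Subgroup.mem_sup_right (mul_mem hxV hzV), ?_, fun L hL hxz => ?_,
    fun k hk N hN hkN => ?_⟩
  · rw [orderOf_eq_zero_iff']
    intro n hn h
    obtain ⟨c, hc⟩ := hpow n hn.ne'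
    exact hc (0, 0) (0, 0) (by rw [h]; rfl)
  · obtain ⟨g, hg⟩ := exists_ne (1 : G)
    obtain ⟨c, hc⟩ := hd g hg
    refine swapGroup_le_of_conj hJ hx hL ?_ hxL ⟨g, rfl⟩ hc
    rintro _ ⟨g, rfl⟩
    have h1 := (commute_of_fix (hκ g) hz).eq
    have : x * φ g * x⁻¹ = (x * z) * φ g * (x * z)⁻¹ := by
      rw [mul_assoc x z, ← h1]
      group
    rw [this]
    exact L.mul_mem (L.mul_mem hxz (hL ⟨g, rfl⟩)) (L.inv_mem hxz)
  · obtain ⟨c, hc⟩ := hpow k (by rintro rfl; exact hk (pow_zero _))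
    exact swapGroup_le_of_displaces hJ hN hkN hc

/-- Every infinite countable set with a base point labels a partition of `ℕ × ℕ` into copies of
`ℕ × ℕ`, in such a way that doubling the coordinates of a point of any of the copies doubles its
coordinates in `ℕ × ℕ`. -/
theorem exists_marking (I : Type) [Countable I] [Infinite I] (i₀ : I) :
    ∃ θ : ℕ × ℕ ≃ I × (ℕ × ℕ), (∀ y, θ (shift false y) = (i₀, y)) ∧
      ∀ c b y, θ (shift c (shift b y)) = ((θ (shift c y)).1, shift b (θ (shift c y)).2) := by
  have : Infinite {i // i ≠ i₀} := (Set.finite_singleton i₀).infinite_compl.to_subtype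
  obtain ⟨e⟩ : Nonempty (ℕ ≃ {i // i ≠ i₀} × ℕ) := nonempty_equiv_of_countable
  obtain ⟨f, hf, ht⟩ : ∃ f : ℕ × ℕ → I × (ℕ × ℕ), (∀ y, f (shift false y) = (i₀, y)) ∧
      ∀ y, f (shift true y) = ((e y.2).1.1, (y.1, (e y.2).2)) := by
    refine ⟨fun y => cond y.1.bodd ((e y.2).1.1, (y.1.div2, (e y.2).2)) (i₀, (y.1.div2, y.2)),
      fun y => ?_, fun y => ?_⟩ <;> simp [shift]
  have hinj : Function.Injective f := by
    intro y y' h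
    obtain ⟨b, z, rfl⟩ := exists_shift y
    obtain ⟨b', z', rfl⟩ := exists_shift y'
    cases b <;> cases b' <;> simp only [hf, ht, Prod.mk.injEq] at h
    · rw [h.2]
    · exact absurd h.1.symm (e z'.2).1.2
    · exact absurd h.1 (e z.2).1.2
    · have : z.2 = z'.2 := e.injective (Prod.ext (Subtype.ext h.1) h.2.2)
      rw [Prod.ext h.2.1 this]
  have hsurj : Function.Surjective f := by
    rintro ⟨i, m, n⟩
    by_cases h : i = i₀
    · exact ⟨shift false (m, n), by rw [hf, h]⟩
    · exact ⟨shift true (m, e.symm (⟨i, h⟩, n)), by simp [ht]⟩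
  refine ⟨Equiv.ofBijective f ⟨hinj, hsurj⟩, hf, fun c b y => ?_⟩
  change f _ = ((f _).1, shift b (f _).2)
  cases c
  · simp only [hf]
  · simp only [ht]
    rfl

theorem exists_maps_of_apart {ι : Type} [Finite ι] {S K : ι → Cell J}
    (hS : Pairwise fun i j => Apart (S i) (S j)) (hK : Pairwise fun i j => Apart (K i) (K j))
    (hSK : ∀ i j, Apart (S i) (K j)) : ∃ u ∈ swapGroup J, ∀ i, Maps u (S i) (K i) := by
  have hF : Pairwise fun p q : ι × Bool =>
      Apart (cond p.2 (K p.1) (S p.1)) (cond q.2 (K q.1) (S q.1)) := by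
    rintro ⟨i, _ | _⟩ ⟨j, _ | _⟩ hne
    · exact hS fun h => hne (congrArg (·, false) h)
    · exact hSK i j
    · exact (hSK j i).symm
    · exact hK fun h => hne (congrArg (·, true) h)
  exact ⟨_, act_mem_swapGroup _ hF ((Equiv.refl ι).prodCongr Equiv.boolNot), fun i =>
    act_maps (hF := hF) ((Equiv.refl ι).prodCongr Equiv.boolNot) (i, false)⟩

theorem exists_maps {ι : Type} [Finite ι] {S T K : ι → Cell J}
    (hS : Pairwise fun i j => Apart (S i) (S j)) (hT : Pairwise fun i j => Apart (T i) (T j))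
    (hK : Pairwise fun i j => Apart (K i) (K j)) (hSK : ∀ i j, Apart (S i) (K j))
    (hTK : ∀ i j, Apart (T i) (K j)) : ∃ u ∈ swapGroup J, ∀ i, Maps u (S i) (T i) := by
  obtain ⟨u, hu, hu'⟩ := exists_maps_of_apart hS hK hSK
  obtain ⟨v, hv, hv'⟩ := exists_maps_of_apart hT hK hTK
  exact ⟨v⁻¹ * u, mul_mem (inv_mem hv) hu, fun i => (hv' i).inv.mul (hu' i)⟩

/-- Some exchanges of cells double all points outside a given tile. -/
theorem exists_doubling {X : Type} [Finite X] (b : Bool) :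
    ∃ u ∈ swapGroup (Option X), ∀ r c y,
      u (some r, shift c y) = (some r, shift c (shift b y)) := by
  have _ := Fintype.ofFinite (X × Bool)
  have i := Fintype.equivFin (X × Bool)
  have hS : ∀ w, Pairwise fun p q : X × Bool =>
      Apart ((some p.1, p.2 :: w) : Cell (Option X)) (some q.1, q.2 :: w) := by
    intro w p q hpq
    rw [apart_iff]
    intro h
    have h1 : p.1 = q.1 := Option.some_injective _ h
    have h2 : p.2 ≠ q.2 := fun h => hpq (Prod.ext h1 h)
    simp [h2, h2.symm]
  obtain ⟨u, hu, h⟩ := exists_maps (hS []) (hS [b])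
    (K := fun p : X × Bool => (none, comb (Fintype.card (X × Bool)) (i p)))
    (fun p q hpq => apart_comb (i p).2.le (i q).2.le fun h => hpq (i.injective (Fin.ext h)))
    (fun _ _ => apart_of_fst_ne (by simp)) (fun _ _ => apart_of_fst_ne (by simp))
  exact ⟨u, hu, fun r c y => h (r, c) y⟩

/-- A permutation group fixing a tile and commuting with the doubling of the points outside of it
consists of products of two conjugates. -/
theorem exists_eq_mul_conj {X : Type} [Finite X] {g : Perm (Pt (Option X))}
    (h0 : ∀ y, g (none, y) = (none, y))
    (h1 : ∀ r c y, ∃ r' c' y', g (some r, shift c y) = (some r', shift c' y') ∧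
      ∀ b, g (some r, shift c (shift b y)) = (some r', shift c' (shift b y'))) :
    ∃ u ∈ swapGroup (Option X), ∃ v ∈ swapGroup (Option X),
      g = (u * g * u⁻¹) * (v * g * v⁻¹) := by
  choose u hu hu' using fun b => exists_doubling (X := X) b
  have hfix : ∀ b p, (∀ r y, p ≠ u b (some r, y)) → (u b * g * (u b)⁻¹) p = p := by
    intro b p hp
    have : g ((u b)⁻¹ p) = (u b)⁻¹ p := by
      rcases h : (u b)⁻¹ p with ⟨_ | r, y⟩
      · exact h0 y
      · exact absurd (by rw [← h, apply_inv]) (hp r y)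
    rw [Perm.mul_apply, Perm.mul_apply, this, apply_inv]
  have hnone : ∀ b y, (u b * g * (u b)⁻¹) (none, y) = (none, y) := by
    refine fun b y => hfix b _ fun r y' h => ?_
    obtain ⟨c, z, rfl⟩ := exists_shift y'
    rw [hu'] at h
    exact absurd (congrArg Prod.fst h) (by simp)
  have hother : ∀ b r c y, (u (!b) * g * (u (!b))⁻¹) (some r, shift c (shift b y)) =
      (some r, shift c (shift b y)) := by
    refine fun b r c y => hfix _ _ fun r y' h => ?_
    obtain ⟨c', z, rfl⟩ := exists_shift y'
    rw [hu'] at h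
    have := (shift_inj (shift_inj (congrArg Prod.snd h)).2).1
    cases b <;> simp at this
  have hsame : ∀ b r c y, (u b * g * (u b)⁻¹) (some r, shift c (shift b y)) =
      g (some r, shift c (shift b y)) := by
    intro b r c y
    obtain ⟨r', c', y', h2, h3⟩ := h1 r c y
    rw [← hu', Perm.mul_apply, Perm.mul_apply, inv_apply, h2, hu', hu', h3]
  refine ⟨u false, hu _, u true, hu _, Equiv.ext ?_⟩
  rintro ⟨_ | r, y⟩
  · rw [Perm.mul_apply, hnone, hnone, h0]
  · obtain ⟨c, y, rfl⟩ := exists_shift y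
    obtain ⟨b, y, rfl⟩ := exists_shift y
    rw [Perm.mul_apply]
    cases b
    · exact ((congrArg _ (hother false r c y)).trans (hsame false r c y)).symm
    · rw [hsame]
      obtain ⟨r', c', y', h2, h3⟩ := h1 r c y
      rw [h3]
      exact (hother true _ _ _).symm

/-- The regular representation of a group, written in terms of a factorisation of the group and
of a marking, and spread over several rows of tiles. -/
noncomputable def rowsHom {G R E A : Type} [Group G] (D : E × A ≃ G)
    (θ : ℕ × ℕ ≃ (A × ℕ) × (ℕ × ℕ)) : G →* Perm (Pt (Option (R × E))) :=
  letI : MulAction G (Pt (Option (R × E))) :=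
    { smul := fun g p => match p with
        | (none, y) => (none, y)
        | (some (r, e), y) => (some (r, (D.symm (g * D (e, (θ y).1.1))).1),
            θ.symm (((D.symm (g * D (e, (θ y).1.1))).2, (θ y).1.2), (θ y).2))
      one_smul := by
        rintro ⟨_ | ⟨r, e⟩, y⟩
        · rfl
        · change (some (r, (D.symm (1 * D (e, (θ y).1.1))).1),
            θ.symm (((D.symm (1 * D (e, (θ y).1.1))).2, (θ y).1.2), (θ y).2)) = (some (r, e), y)
          simp
      mul_smul := by
        rintro g h ⟨_ | ⟨r, e⟩, y⟩
        · rfl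
        · change (some _, θ.symm _) = (some _, θ.symm _)
          simp [mul_assoc] }
  MulAction.toPermHom G (Pt (Option (R × E)))

section rowsHom

variable {G R E A : Type} [Group G] {D : E × A ≃ G} {θ : ℕ × ℕ ≃ (A × ℕ) × (ℕ × ℕ)}

theorem rowsHom_some (g : G) (r : R) (e : E) (y : ℕ × ℕ) :
    rowsHom D θ g (some (r, e), y) = (some (r, (D.symm (g * D (e, (θ y).1.1))).1),
      θ.symm (((D.symm (g * D (e, (θ y).1.1))).2, (θ y).1.2), (θ y).2)) := rfl

end rowsHom

theorem exists_rowsHom {G R E A : Type} [Group G] [Countable A] [Finite R] [Finite E] [Nonempty R]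
    (ε : E → G) (μ : A → G) (hD : Function.Bijective fun p : E × A => ε p.1 * μ p.2) :
    ∃ φ : G →* Perm (Pt (Option (R × E))), (∀ g, Maps (φ g) (none, []) (none, [])) ∧
      (∀ g e e', g * ε e = ε e' → ∀ r, Maps (φ g) (some (r, e), []) (some (r, e'), [])) ∧
      (∀ g, g ≠ 1 → ∃ c : Cell (Option (R × E)), ∀ y z, φ g (place c y) ≠ place c z) ∧
      ∀ g, ∃ u ∈ swapGroup (Option (R × E)), ∃ v ∈ swapGroup (Option (R × E)),
        φ g = (u * φ g * u⁻¹) * (v * φ g * v⁻¹) := by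
  obtain ⟨D, hDe⟩ : ∃ D : E × A ≃ G, ∀ p, D p = ε p.1 * μ p.2 :=
    ⟨Equiv.ofBijective _ hD, fun _ => rfl⟩
  obtain ⟨e₀, a₀⟩ := D.symm 1
  have : Nonempty A := ⟨a₀⟩
  obtain ⟨θ, h1, h2⟩ := exists_marking (A × ℕ) (a₀, 0)
  refine ⟨rowsHom D θ, fun g y => rfl, fun g e e' h r y => ?_, fun g hg => ?_, fun g => ?_⟩
  · have : g * D (e, (θ y).1.1) = D (e', (θ y).1.1) := by
      rw [hDe, hDe, ← mul_assoc, h]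
    change rowsHom D θ g (some (r, e), y) = (some (r, e'), y)
    rw [rowsHom_some, this]
    simp
  · obtain ⟨r⟩ := ‹Nonempty R›
    refine ⟨(some (r, e₀), [false]), fun y z h => hg ?_⟩
    change rowsHom D θ g (some (r, e₀), shift false y) = (some (r, e₀), shift false z) at h
    rw [rowsHom_some, Prod.mk.injEq, Equiv.symm_apply_eq, h1, h1] at h
    simp only [Option.some.injEq, Prod.mk.injEq] at h
    have : D.symm (g * D (e₀, a₀)) = (e₀, a₀) := Prod.ext h.1.2 h.2.1.1
    rw [Equiv.symm_apply_eq] at this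
    exact mul_eq_right.1 this
  · refine exists_eq_mul_conj (fun y => rfl) ?_
    rintro ⟨r, e⟩ c y
    obtain ⟨c', y', h⟩ := exists_shift (θ.symm (((D.symm (g * D (e, (θ (shift c y)).1.1))).2,
      (θ (shift c y)).1.2), (θ (shift c y)).2))
    refine ⟨(r, (D.symm (g * D (e, (θ (shift c y)).1.1))).1), c', y', ?_, fun b => ?_⟩
    · rw [rowsHom_some, h]
    · rw [rowsHom_some, h2]
      rw [Equiv.symm_apply_eq] at h
      refine Prod.ext rfl ?_
      rw [Equiv.symm_apply_eq, h2, ← h]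

theorem exists_notMem_of_card [Finite J] {n : ℕ} (h : n < Nat.card J) (s : List J)
    (hs : s.length ≤ n) : ∃ j, j ∉ s := by
  classical
  by_contra! hall
  have := Fintype.ofFinite J
  have h1 : Finset.univ ⊆ s.toFinset := fun j _ => List.mem_toFinset.2 (hall j)
  have h2 := (Finset.card_le_card h1).trans s.toFinset_card_le
  rw [Finset.card_univ, ← Nat.card_eq_fintype_card] at h2
  omega

theorem exists_order_of_rot {G : Type} [Group G] (φ : G →* Perm (Pt J))
    (hJ : ∀ s : List J, s.length ≤ 4 → ∃ j, j ∉ s) {ι : Type} [Finite ι] [Nonempty ι] {p : ℕ}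
    (hp : 2 ≤ p) (F : ι × Fin p → Cell J) (hF : Pairwise fun i j => Apart (F i) (F j))
    (hL : ∀ L : Subgroup (Perm (Pt J)), φ.range ≤ L → rot F hF ∈ L → swapGroup J ≤ L) :
    ∃ x ∈ φ.range ⊔ swapGroup J, orderOf x = p ∧
      (∀ L : Subgroup (Perm (Pt J)), φ.range ≤ L → x ∈ L → swapGroup J ≤ L) ∧
      ∀ k, x ^ k ≠ 1 → ∀ N : Subgroup (Perm (Pt J)),
        (∀ v ∈ swapGroup J, ∀ n ∈ N, v * n * v⁻¹ ∈ N) → x ^ k ∈ N → swapGroup J ≤ N := by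
  refine ⟨rot F hF, Subgroup.mem_sup_right (act_mem_swapGroup _ _ _), orderOf_rot hp F hF, hL,
    fun k hk N hN hkN => ?_⟩
  obtain ⟨c, hc⟩ := rot_pow_displaces hk
  exact swapGroup_le_of_displaces hJ hN hkN hc

theorem exists_order_of_conj {G : Type} [Group G] (φ : G →* Perm (Pt J))
    (hJ : ∀ s : List J, s.length ≤ 4 → ∃ j, j ∉ s)
    (hd : ∀ g, g ≠ 1 → ∃ c : Cell J, ∀ y z, φ g (place c y) ≠ place c z)
    {x : Perm (Pt J)} (hx : x * x = 1) (hxV : x ∈ swapGroup J) {a : G} (ha : a ≠ 1)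
    (hL : ∀ L : Subgroup (Perm (Pt J)), φ a ∈ L → x ∈ L → swapGroup J ≤ L) :
    ∃ x ∈ φ.range ⊔ swapGroup J, orderOf x = orderOf a ∧
      (∀ L : Subgroup (Perm (Pt J)), φ.range ≤ L → x ∈ L → swapGroup J ≤ L) ∧
      ∀ k, x ^ k ≠ 1 → ∀ N : Subgroup (Perm (Pt J)),
        (∀ v ∈ swapGroup J, ∀ n ∈ N, v * n * v⁻¹ ∈ N) → x ^ k ∈ N → swapGroup J ≤ N := by
  have hφ : Function.Injective φ := by
    rw [injective_iff_map_eq_one]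
    intro g hg
    by_contra h
    obtain ⟨c, hc⟩ := hd g h
    exact hc (0, 0) (0, 0) (by rw [hg]; rfl)
  have hpow : ∀ k : ℕ, (x * φ a * x⁻¹) ^ k = x * φ (a ^ k) * x⁻¹ := fun k => by
    rw [conj_pow, map_pow]
  refine ⟨x * φ a * x⁻¹, ?_, ?_, fun L hφL hxL => ?_, fun k hk N hN hkN => ?_⟩
  · have hx' := (le_sup_right : _ ≤ φ.range ⊔ swapGroup J) hxV
    exact mul_mem (mul_mem hx' (Subgroup.mem_sup_left ⟨a, rfl⟩)) (inv_mem hx')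
  · rw [← orderOf_injective φ hφ]
    exact orderOf_injective (MulAut.conj x).toMonoidHom (MulAut.conj x).injective (φ a)
  · obtain ⟨c, hc⟩ := hd a ha
    have hB : Subgroup.zpowers (φ a) ≤ L := by
      rw [Subgroup.zpowers_le]
      exact hφL ⟨a, rfl⟩
    refine swapGroup_le_of_conj hJ hx hB ?_ (fun K hK hxK => hL K (hK ?_) hxK)
      (Subgroup.mem_zpowers _) hc
    · rintro _ ⟨k, rfl⟩
      change x * φ a ^ k * x⁻¹ ∈ L
      rw [← conj_zpow]
      exact L.zpow_mem hxL k
    · exact Subgroup.mem_zpowers _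
  · rw [hpow] at hk hkN
    have hak : a ^ k ≠ 1 := fun h => hk (by rw [h, map_one, mul_one, mul_inv_cancel])
    have := hN x⁻¹ (inv_mem hxV) _ hkN
    have e : x⁻¹ * (x * φ (a ^ k) * x⁻¹) * x⁻¹⁻¹ = φ (a ^ k) := by group
    rw [e] at this
    obtain ⟨c, hc⟩ := hd _ hak
    exact swapGroup_le_of_displaces hJ hN this hc

theorem involution_mul_involution : involution * involution = 1 := by
  have := pow_orderOf_eq_one involution
  rwa [involution, orderOf_rot le_rfl, sq] at this

theorem exists_simple_of_order_three {G : Type} [Group G] (φ : G →* Perm (Pt TwoRows))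
    (hκ : ∀ g, Maps (φ g) (none, []) (none, []))
    (hd : ∀ g, g ≠ 1 → ∃ c : Cell TwoRows, ∀ y z, φ g (place c y) ≠ place c z)
    (hk : ∀ g, ∃ u ∈ swapGroup TwoRows, ∃ v ∈ swapGroup TwoRows,
      φ g = (u * φ g * u⁻¹) * (v * φ g * v⁻¹))
    {a : G} (ha : orderOf a = 3) (haJ : ∀ j, Maps (φ a) (j, []) (rowShift j, [])) :
    ∃ (S : Type) (_ : Group S), IsSimpleGroup S ∧ ∃ φ : G →* S, Function.Injective φ ∧
      ∀ p : ℕ, (p = 0 ∨ 2 ≤ p) →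
        ∃ x : S, orderOf x = p ∧ Subgroup.closure (Set.range φ ∪ {x}) = ⊤ := by
  have hJ : ∀ s : List TwoRows, s.length ≤ 4 → ∃ j, j ∉ s :=
    exists_notMem_of_card (by rw [Nat.card_eq_fintype_card]; decide)
  have ha1 : a ≠ 1 := by
    rintro rfl
    simp at ha
  have : Nontrivial G := ⟨a, 1, ha1⟩
  have hV : involution ∈ swapGroup TwoRows := act_mem_swapGroup _ _ _
  have hL : ∀ L : Subgroup (Perm (Pt TwoRows)), φ a ∈ L → involution ∈ L →
      swapGroup TwoRows ≤ L := fun L => swapGroup_le_of_involution haJ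
  have hL' : ∀ L : Subgroup (Perm (Pt TwoRows)), φ.range ≤ L → involution ∈ L →
      swapGroup TwoRows ≤ L := fun L h => hL L (h ⟨a, rfl⟩)
  refine exists_simple_of_hom φ hJ hk hd fun p hp => ?_
  obtain rfl | rfl | rfl | hp : p = 0 ∨ p = 2 ∨ p = 3 ∨ 4 ≤ p := by omega
  · exact exists_infinite_order φ hJ hd hκ involution_mul_involution hV (involution_maps 2 0)
      (by decide) hL'
  · exact exists_order_of_rot φ hJ le_rfl _ involutionCells_apart hL'
  · have := exists_order_of_conj φ hJ hd involution_mul_involution hV ha1 hL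
    rwa [ha] at this
  · exact exists_order_of_rot φ hJ (by omega) _ (rowsCells_apart hp) fun L h =>
      swapGroup_le_of_rowsRot hp haJ (h ⟨a, rfl⟩)

theorem exists_simple_of_isSquare [Finite J] {G : Type} [Group G] (φ : G →* Perm (Pt J))
    {t : Fin 5 → J} {c d : G} (H : IsSquare t (φ c) (φ d))
    (hκ : ∀ g, Maps (φ g) (t 0, []) (t 0, []))
    (hd : ∀ g, g ≠ 1 → ∃ c : Cell J, ∀ y z, φ g (place c y) ≠ place c z)
    (hk : ∀ g, ∃ u ∈ swapGroup J, ∃ v ∈ swapGroup J,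
      φ g = (u * φ g * u⁻¹) * (v * φ g * v⁻¹)) :
    ∃ (S : Type) (_ : Group S), IsSimpleGroup S ∧ ∃ φ : G →* S, Function.Injective φ ∧
      ∀ p : ℕ, (p = 0 ∨ 2 ≤ p) →
        ∃ x : S, orderOf x = p ∧ Subgroup.closure (Set.range φ ∪ {x}) = ⊤ := by
  have hJ : ∀ s : List J, s.length ≤ 4 → ∃ j, j ∉ s := by
    refine exists_notMem_of_card ?_
    have := Nat.card_le_card_of_injective t H.inj
    rw [Nat.card_fin] at this
    omega
  have : Nontrivial G := by
    refine ⟨c, 1, fun h => ?_⟩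
    have := H.c1 (0, 0)
    rw [h, map_one] at this
    exact H.inj.ne (by decide : (1 : Fin 5) ≠ 2) (congrArg Prod.fst this)
  have hL : ∀ L : Subgroup (Perm (Pt J)), φ.range ≤ L → squareInv H.inj ∈ L →
      swapGroup J ≤ L := fun L h => H.swapGroup_le_of_squareInv (h ⟨c, rfl⟩) (h ⟨d, rfl⟩)
  refine exists_simple_of_hom φ hJ hk hd fun p hp => ?_
  obtain rfl | rfl | hp : p = 0 ∨ p = 2 ∨ 3 ≤ p := by omega
  · refine exists_infinite_order φ hJ hd hκ (inv_eq_iff_mul_eq_one.1 (squareInv_inv H.inj))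
      (act_mem_swapGroup _ _ _) (squareInv_maps H.inj 0 0) (H.inj.ne (by decide)) hL
  · exact exists_order_of_rot φ hJ le_rfl _ (squareInvCells_apart H.inj) hL
  · exact exists_order_of_rot φ hJ (by omega) _ (squareCells_apart hp (H.inj.ne (by decide))
      (H.inj.ne (by decide)) (H.inj.ne (by decide))) fun L h =>
      H.swapGroup_le_of_squareRot (h ⟨c, rfl⟩) (h ⟨d, rfl⟩) hp

/-- A factorisation of a subgroup extends to a factorisation of the group. -/
theorem exists_bijective_mul {G E K : Type} [Group G] [Countable G] [Countable K]
    (H : Subgroup G) (ε : E → G) (κ : K → G)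
    (hi : Function.Injective fun p : E × K => ε p.1 * κ p.2)
    (hr : Set.range (fun p : E × K => ε p.1 * κ p.2) = H) :
    ∃ (A : Type) (_ : Countable A) (μ : A → G),
      Function.Bijective fun p : E × A => ε p.1 * μ p.2 := by
  obtain ⟨T, hT, -⟩ := H.exists_isComplement_right 1
  have hm : ∀ p : E × K, ε p.1 * κ p.2 ∈ (H : Set G) := fun p => hr ▸ ⟨p, rfl⟩
  refine ⟨K × T, inferInstance, fun q => κ q.1 * q.2, ?_, fun g => ?_⟩
  · rintro ⟨e, k, t⟩ ⟨e', k', t'⟩ h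
    have h' : (ε e * κ k) * (t : G) = (ε e' * κ k') * (t' : G) := by
      simpa only [mul_assoc] using h
    have := @hT.1 (⟨_, hm (e, k)⟩, t) (⟨_, hm (e', k')⟩, t') h'
    rw [Prod.mk.injEq, Subtype.mk.injEq] at this
    have h1 := @hi (e, k) (e', k') this.1
    rw [Prod.mk.injEq] at h1
    rw [h1.1, h1.2, this.2]
  · obtain ⟨⟨⟨h, hh⟩, t⟩, rfl⟩ := hT.2 g
    rw [← hr] at hh
    obtain ⟨⟨e, k⟩, rfl⟩ := hh
    exact ⟨(e, k, t), by simp only [mul_assoc]⟩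

theorem exists_bijective_pow {G : Type} [Group G] [Countable G] {c : G} {n : ℕ} (hc : orderOf c = n)
    (hn : n ≠ 0) : ∃ (A : Type) (_ : Countable A) (μ : A → G),
      Function.Bijective fun p : Fin n × A => c ^ (p.1 : ℕ) * μ p.2 := by
  subst hc
  have hc : IsOfFinOrder c := orderOf_ne_zero_iff.1 hn
  refine exists_bijective_mul (Subgroup.zpowers c) (fun i : Fin (orderOf c) => c ^ (i : ℕ))
    (fun _ : Unit => 1) ?_ ?_
  · rintro ⟨i, ⟨⟩⟩ ⟨j, ⟨⟩⟩ h
    simp only [mul_one] at h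
    rw [Fin.ext (pow_injOn_Iio_orderOf (Set.mem_Iio.2 i.2) (Set.mem_Iio.2 j.2) h)]
  · ext g
    simp only [mul_one, Set.mem_range, Prod.exists, SetLike.mem_coe]
    constructor
    · rintro ⟨i, -, rfl⟩
      exact Subgroup.npow_mem_zpowers c i
    · intro hg
      obtain ⟨i, hi⟩ := (finEquivZPowers hc).surjective ⟨g, hg⟩
      exact ⟨i, (), congrArg Subtype.val hi⟩

theorem exists_bijective_zpow {G : Type} [Group G] [Countable G] {c : G} (hc : orderOf c = 0)
    {n : ℕ} (hn : n ≠ 0) : ∃ (A : Type) (_ : Countable A) (μ : A → G),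
      Function.Bijective fun p : Fin n × A => c ^ (p.1 : ℕ) * μ p.2 := by
  refine exists_bijective_mul (Subgroup.zpowers c) (fun i : Fin n => c ^ (i : ℕ))
    (fun k : ℤ => c ^ (n * k)) ?_ ?_
  · rintro ⟨i, k⟩ ⟨j, l⟩ h
    simp only [← zpow_natCast c, ← zpow_add] at h
    have h := injective_zpow_iff_not_isOfFinOrder.2 (orderOf_eq_zero_iff.1 hc) h
    have hij : (i : ℤ) = j := by
      have := congrArg (· % (n : ℤ)) h
      simp only [Int.add_mul_emod_self_left] at this
      rwa [Int.emod_eq_of_lt (by omega) (by omega), Int.emod_eq_of_lt (by omega) (by omega)] at this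
    rw [hij, add_right_inj, mul_right_inj' (by omega)] at h
    rw [Prod.mk.injEq]
    exact ⟨Fin.ext (by omega), h⟩
  · ext g
    simp only [← zpow_natCast c, ← zpow_add, Set.mem_range, Prod.exists, SetLike.mem_coe]
    constructor
    · rintro ⟨i, k, rfl⟩
      exact Subgroup.zpow_mem_zpowers c _
    · rintro ⟨m, rfl⟩
      have h0 := Int.emod_nonneg m (by omega : (n : ℤ) ≠ 0)
      have h1 := Int.emod_lt_of_pos m (by omega : (0 : ℤ) < n)
      refine ⟨⟨(m % n).toNat, by omega⟩, m / n, ?_⟩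
      rw [Int.toNat_of_nonneg h0, Int.emod_add_mul_ediv]

theorem exists_simple_of_square {G E A : Type} [Group G] [Countable A] [Finite E]
    (ε : E → G) (μ : A → G) (hD : Function.Bijective fun p : E × A => ε p.1 * μ p.2)
    (c d : G) (t : Fin 4 → E) (ht : Function.Injective t) (c0 : c * ε (t 0) = ε (t 1))
    (c1 : ∃ e, e ≠ t 1 ∧ e ≠ t 2 ∧ e ≠ t 3 ∧ c * ε (t 1) = ε e) (c2 : c * ε (t 2) = ε (t 3))
    (d0 : d * ε (t 0) = ε (t 2)) (d1 : d * ε (t 1) = ε (t 3))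
    (reach : ∀ P : E → Prop, P (t 0) →
      (∀ e e', (c * ε e = ε e' ∨ d * ε e = ε e') → P e → P e') → ∀ e, P e) :
    ∃ (S : Type) (_ : Group S), IsSimpleGroup S ∧ ∃ φ : G →* S, Function.Injective φ ∧
      ∀ p : ℕ, (p = 0 ∨ 2 ≤ p) →
        ∃ x : S, orderOf x = p ∧ Subgroup.closure (Set.range φ ∪ {x}) = ⊤ := by
  obtain ⟨φ, hκ, hφ, hd, hk⟩ := exists_rowsHom (R := Unit) ε μ hD
  have hs : Function.Injective fun e : E => some ((), e) := fun e e' h => by simpa using h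
  have H : IsSquare (Fin.cons none fun i => some ((), t i)) (φ c) (φ d) := by
    obtain ⟨e, e1, e2, e3, he⟩ := c1
    exact
      { inj := Fin.cons_injective_iff.2 ⟨by simp, hs.comp ht⟩
        c0 := hκ c
        c1 := hφ _ _ _ c0 ()
        c2 := ⟨some ((), e), by simp, hs.ne e1, hs.ne e2, hs.ne e3, hφ _ _ _ he ()⟩
        c3 := hφ _ _ _ c2 ()
        d0 := hκ d
        d1 := hφ _ _ _ d0 ()
        d2 := hφ _ _ _ d1 ()
        reach := by
          rintro P hP hstep (_ | ⟨⟨⟩, e⟩) hj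
          · exact absurd rfl hj
          · refine reach (fun e => P (some ((), e))) hP (fun e e' h => hstep _ _ ?_) e
            exact h.imp (fun h => hφ _ _ _ h ()) (fun h => hφ _ _ _ h ()) }
  exact exists_simple_of_isSquare φ H hκ hd hk

theorem exists_simple_of_five_le {G A : Type} [Group G] [Countable A] {c : G} {n : ℕ} (hn : 5 ≤ n)
    (μ : A → G) (hD : Function.Bijective fun p : Fin n × A => c ^ (p.1 : ℕ) * μ p.2) :
    ∃ (S : Type) (_ : Group S), IsSimpleGroup S ∧ ∃ φ : G →* S, Function.Injective φ ∧
      ∀ p : ℕ, (p = 0 ∨ 2 ≤ p) →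
        ∃ x : S, orderOf x = p ∧ Subgroup.closure (Set.range φ ∪ {x}) = ⊤ := by
  refine exists_simple_of_square (fun i : Fin n => c ^ (i : ℕ)) μ hD c (c ^ 3)
    ![⟨0, by omega⟩, ⟨1, by omega⟩, ⟨3, by omega⟩, ⟨4, by omega⟩] ?_ ?_ ?_ ?_ ?_ ?_ ?_
  · intro i j
    fin_cases i <;> fin_cases j <;> simp
  · simp
  · exact ⟨⟨2, by omega⟩, by simp, by simp, by simp, by simp [sq]⟩
  · simp [← pow_succ']
  · simp
  · simp [← pow_succ]
  · rintro P h0 h ⟨i, hi⟩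
    induction i with
    | zero => exact h0
    | succ i ih => exact h ⟨i, by omega⟩ _ (Or.inl (pow_succ' c i).symm) (ih _)

theorem exists_simple_of_order_four {G : Type} [Group G] [Countable G] {h : G}
    (hh : orderOf h = 4) :
    ∃ (S : Type) (_ : Group S), IsSimpleGroup S ∧ ∃ φ : G →* S, Function.Injective φ ∧
      ∀ p : ℕ, (p = 0 ∨ 2 ≤ p) →
        ∃ x : S, orderOf x = p ∧ Subgroup.closure (Set.range φ ∪ {x}) = ⊤ := by
  obtain ⟨A, _, μ, hD⟩ := exists_bijective_pow hh (by decide)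
  have h4 : h ^ 4 = 1 := hh ▸ pow_orderOf_eq_one h
  refine exists_simple_of_square (fun i : Fin 4 => h ^ (i : ℕ)) μ hD (h ^ 2) h
    ![0, 2, 1, 3] (by decide) ?_ ?_ ?_ ?_ ?_ ?_
  · simp
  · exact ⟨0, by decide, by decide, by decide, by simp [← pow_add, h4]⟩
  · simp [← pow_succ]
  · simp
  · simp [← pow_succ']
  · rintro P h0 hs ⟨i, hi⟩
    induction i with
    | zero => exact h0
    | succ i ih => exact hs ⟨i, by omega⟩ _ (Or.inr (pow_succ' h i).symm) (ih _)

theorem exists_simple_of_exponent_two {G : Type} [Group G] [Countable G] (h2 : ∀ g : G, g * g = 1)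
    {x y : G} (hx : x ≠ 1) (hy : y ≠ 1) (hxy : x ≠ y) :
    ∃ (S : Type) (_ : Group S), IsSimpleGroup S ∧ ∃ φ : G →* S, Function.Injective φ ∧
      ∀ p : ℕ, (p = 0 ∨ 2 ≤ p) →
        ∃ x : S, orderOf x = p ∧ Subgroup.closure (Set.range φ ∪ {x}) = ⊤ := by
  have hc : y * x = x * y := by
    have hi : ∀ g : G, g⁻¹ = g := fun g => inv_eq_of_mul_eq_one_right (h2 g)
    rw [← hi (x * y), mul_inv_rev, hi, hi]
  have hx2 : ∀ g, x * (x * g) = g := fun g => by rw [← mul_assoc, h2, one_mul]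
  have hy2 : ∀ g, y * (y * g) = g := fun g => by rw [← mul_assoc, h2, one_mul]
  have hc2 : ∀ g, y * (x * g) = x * (y * g) := fun g => by rw [← mul_assoc, hc, mul_assoc]
  let ε : Fin 4 → G := ![1, x, y, x * y]
  let H : Subgroup G :=
    { carrier := Set.range ε
      one_mem' := ⟨0, rfl⟩
      mul_mem' := by
        rintro _ _ ⟨i, rfl⟩ ⟨j, rfl⟩
        refine ⟨![![0, 1, 2, 3], ![1, 0, 3, 2], ![2, 3, 0, 1], ![3, 2, 1, 0]] i j, ?_⟩
        fin_cases i <;> fin_cases j <;> simp [ε, mul_assoc, h2, hc, hx2, hc2]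
      inv_mem' := by
        rintro _ ⟨i, rfl⟩
        exact ⟨i, (inv_eq_of_mul_eq_one_right (h2 _)).symm⟩ }
  have hε : Function.Injective ε := by
    have h' : x * y ≠ 1 := fun h => hxy (by rw [← hx2 y, h, mul_one])
    intro i j
    fin_cases i <;> fin_cases j <;>
      simp [ε, hx, hy, hxy, h', hx.symm, hy.symm, hxy.symm, h'.symm]
  obtain ⟨A, _, μ, hD⟩ := exists_bijective_mul H ε (fun _ : Unit => 1)
    (fun p q h => Prod.ext (hε (by simpa using h)) rfl) (by
      ext g
      simp only [mul_one, Set.mem_range, Prod.exists, exists_const]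
      rfl)
  refine exists_simple_of_square ε μ hD x y id Function.injective_id ?_ ?_ ?_ ?_ ?_ ?_
  · exact mul_one x
  · exact ⟨0, by decide, by decide, by decide, h2 x⟩
  · rfl
  · exact mul_one y
  · exact hc
  · intro P h0 h i
    have p1 : P 1 := h 0 1 (Or.inl (mul_one x)) h0
    have p2 : P 2 := h 0 2 (Or.inr (mul_one y)) h0
    have p3 : P 3 := h 1 3 (Or.inr hc) p1
    fin_cases i <;> assumption

theorem exists_simple_of_orderOf_eq_three {G : Type} [Group G] [Countable G] {a : G}
    (ha : orderOf a = 3) :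
    ∃ (S : Type) (_ : Group S), IsSimpleGroup S ∧ ∃ φ : G →* S, Function.Injective φ ∧
      ∀ p : ℕ, (p = 0 ∨ 2 ≤ p) →
        ∃ x : S, orderOf x = p ∧ Subgroup.closure (Set.range φ ∪ {x}) = ⊤ := by
  obtain ⟨A, _, μ, hD⟩ := exists_bijective_pow ha (by decide)
  obtain ⟨φ, hκ, hφ, hd, hk⟩ := exists_rowsHom (R := Fin 2) (fun i : Fin 3 => a ^ (i : ℕ)) μ hD
  refine exists_simple_of_order_three φ hκ hd hk ha ?_
  rintro (_ | ⟨r, i⟩)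
  · exact hκ a
  · refine hφ _ _ _ ?_ r
    have h3 : a ^ 3 = 1 := ha ▸ pow_orderOf_eq_one a
    fin_cases i
    · simp
    · simp [sq]
    · simp [← pow_succ', h3]

end CellPerm

/-- Corollary A (second part): every countable group `G` with at least 3 elements
embeds into a simple group `S` which, for every `p ∈ {2,3,...} ∪ {∞}`, is generated
by the image of `G` together with a single element of order `p` (order `0` encodes `∞`). -/
theorem embedding_into_simple_group_generated_by_G_and_element_of_any_order
    (G : Type) [Group G] [Countable G] (hG : 3 ≤ Cardinal.mk G) :
    ∃ (S : Type) (_ : Group S),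
      IsSimpleGroup S ∧
      ∃ φ : G →* S, Function.Injective φ ∧
        ∀ p : ℕ, (p = 0 ∨ 2 ≤ p) →
          ∃ x : S, orderOf x = p ∧ Subgroup.closure (Set.range φ ∪ {x}) = ⊤ := by
  by_cases h3 : ∃ a : G, orderOf a = 3
  · obtain ⟨a, ha⟩ := h3
    exact CellPerm.exists_simple_of_orderOf_eq_three ha
  by_cases h4 : ∃ a : G, orderOf a = 4
  · obtain ⟨a, ha⟩ := h4
    exact CellPerm.exists_simple_of_order_four ha
  by_cases h5 : ∃ a : G, 5 ≤ orderOf a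
  · obtain ⟨a, ha⟩ := h5
    obtain ⟨A, _, μ, hD⟩ := CellPerm.exists_bijective_pow (rfl : orderOf a = _) (by omega)
    exact CellPerm.exists_simple_of_five_le ha _ hD
  by_cases h0 : ∃ a : G, orderOf a = 0
  · obtain ⟨a, ha⟩ := h0
    obtain ⟨A, _, μ, hD⟩ := CellPerm.exists_bijective_zpow ha (n := 5) (by decide)
    exact CellPerm.exists_simple_of_five_le le_rfl _ hD
  push Not at h3 h4 h5 h0
  have h2 : ∀ g : G, g * g = 1 := by
    intro g
    have := h3 g
    have := h4 g
    have := h5 g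
    have := h0 g
    rw [← sq]
    exact orderOf_dvd_iff_pow_eq_one.1 (by interval_cases orderOf g <;> simp_all)
  obtain ⟨x, hx, -⟩ := Cardinal.exists_ne_ne_of_three_le hG 1 1
  obtain ⟨y, hy, hxy⟩ := Cardinal.exists_ne_ne_of_three_le hG 1 x
  exact CellPerm.exists_simple_of_exponent_two h2 hx hy hxy.symm
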